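/- arXiv:2509.15914 — 8 statements merged into one kernel-verified Lean document; each statement's English description precedes it below -/
import Mathlib

section
/- Let L be a finite lattice and 𝓧 ⊆ L∖{⊥}. Then the collection of L-building sets containing 𝓧 has a unique inclusion-minimal element 𝓧̃, called the L-building closure of 𝓧. Moreover, every Y ∈ 𝓧̃∖𝓧 has the property that there is no order isomorphism from the product poset ∏_{X ∈ max(𝓧_{≤Y})} L_{≤X} onto L_{≤Y} whose components are the interval inclusions, where max(𝓧_{≤Y}) denotes the set of inclusion-maximal elements of {X ∈ 𝓧 : X ≤ Y}. -/
section LatticePrelims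

variable {L : Type*} [Lattice L] [BoundedOrder L]

/-- The inclusion-maximal elements of `B` that lie below `Y`. -/
def maxBelow (B : Set L) (Y : L) : Set L :=
  {X | X ∈ B ∧ X ≤ Y ∧ ∀ Z ∈ B, Z ≤ Y → X ≤ Z → X = Z}

/-- The interval below `Y` factors as the product of the intervals below the maximal elements
of `B` below `Y`, via an order isomorphism whose components are the interval inclusions
(i.e. it sends every tuple that is `⊥` away from the coordinate `X` to its `X`-th entry). -/
def HasFactorization (B : Set L) (Y : L) : Prop :=
  ∃ φ : {t : maxBelow B Y → L // ∀ X, t X ≤ (X : L)} ≃o Set.Iic Y,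
    ∀ (t : {t : maxBelow B Y → L // ∀ X, t X ≤ (X : L)}) (X : maxBelow B Y),
      (∀ X', X' ≠ X → t.val X' = ⊥) → (φ t : L) = t.val X

/-- `B` is a building set of the lattice `L` (Feichtner–Kozlov). -/
def IsLatBuilding (B : Set L) : Prop :=
  (⊥ : L) ∉ B ∧ ∀ Y : L, ⊥ < Y → HasFactorization B Y

end LatticePrelims

section Decomposition

variable {L : Type*} [Lattice L]

/-- The map `W ↦ (W ⊓ X)_{X ∈ S}` is an order isomorphism from `[⊥, Y]` onto the product of the
intervals `[⊥, X]` for `X ∈ S`, expressed elementwise. -/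
structure Decomposes (S : Set L) (Y : L) : Prop where
  le : ∀ X ∈ S, X ≤ Y
  le_of_inf_le : ∀ W ≤ Y, ∀ U, (∀ X ∈ S, W ⊓ X ≤ U) → W ≤ U
  exists_inf_eq : ∀ t : L → L, (∀ X ∈ S, t X ≤ X) → ∃ U ≤ Y, ∀ X ∈ S, U ⊓ X = t X

theorem decomposes_singleton (Y : L) : Decomposes {Y} Y where
  le := by simp
  le_of_inf_le := fun W hW U h => by simpa [hW] using h Y rfl
  exists_inf_eq := fun t ht => ⟨t Y, ht Y rfl, by rintro X rfl; simpa using ht X rfl⟩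

/-- A decomposition of `[⊥, Y]` restricts to every smaller interval `[⊥, Z]`. -/
theorem Decomposes.restrict {S : Set L} {Y Z : L} (h : Decomposes S Y) (hZ : Z ≤ Y) :
    Decomposes ((fun X => Z ⊓ X) '' S) Z where
  le := by
    rintro _ ⟨X, -, rfl⟩
    exact inf_le_left
  le_of_inf_le := by
    intro W hW U hU
    refine h.le_of_inf_le W (hW.trans hZ) U fun X hX => ?_
    simpa [← inf_assoc, hW] using hU _ ⟨X, hX, rfl⟩
  exists_inf_eq := by
    intro t ht
    have htZ : ∀ X ∈ S, t (Z ⊓ X) ≤ Z ⊓ X := fun X hX => ht _ ⟨X, hX, rfl⟩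
    obtain ⟨U, hUY, hU⟩ := h.exists_inf_eq (fun X => t (Z ⊓ X))
      fun X hX => (htZ X hX).trans inf_le_right
    have hUZ : U ≤ Z := h.le_of_inf_le U hUY Z fun X hX =>
      (hU X hX).trans_le ((htZ X hX).trans inf_le_left)
    refine ⟨U, hUZ, ?_⟩
    rintro _ ⟨X, hX, rfl⟩
    rw [← inf_assoc, inf_eq_left.mpr hUZ, hU X hX]

theorem maxBelow_of_mem {D : Set L} {Y : L} (hY : Y ∈ D) : maxBelow D Y = {Y} := by
  ext X
  constructor
  · exact fun hX => hX.2.2 Y hY le_rfl hX.2.1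
  · rintro rfl
    exact ⟨hY, le_rfl, fun Z _ hZ hXZ => le_antisymm hXZ hZ⟩

theorem exists_le_mem_maxBelow [Finite L] {B : Set L} {E Y : L} (hE : E ∈ B) (hEY : E ≤ Y) :
    ∃ X ∈ maxBelow B Y, E ≤ X := by
  obtain ⟨X, hEX, hX⟩ :=
    (Set.toFinite {Z | Z ∈ B ∧ Z ≤ Y}).exists_le_maximal (a := E) ⟨hE, hEY⟩
  exact ⟨X, ⟨hX.prop.1, hX.prop.2, fun Z hZ hZY hXZ => hX.eq_of_le ⟨hZ, hZY⟩ hXZ⟩, hEX⟩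

variable [BoundedOrder L]

theorem decomposes_empty_bot : Decomposes (∅ : Set L) ⊥ where
  le := by simp
  le_of_inf_le := fun _ hW _ _ => hW.trans bot_le
  exists_inf_eq := fun _ _ => ⟨⊥, le_rfl, by simp⟩

theorem Decomposes.inf_eq_bot {S : Set L} {Y : L} (h : Decomposes S Y) {X X' : L}
    (hX : X ∈ S) (hX' : X' ∈ S) (hne : X ≠ X') : X ⊓ X' = ⊥ := by
  classical
  obtain ⟨U, -, hU⟩ := h.exists_inf_eq (fun Z => if Z = X then X else ⊥) (by
    intro Z _
    split_ifs with hZ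
    · exact hZ.ge
    · exact bot_le)
  have hUX : U ⊓ X = X := by simpa using hU X hX
  have hUX' : U ⊓ X' = ⊥ := by simpa [hne.symm] using hU X' hX'
  rw [eq_bot_iff, ← hUX']
  exact inf_le_inf_right _ (inf_eq_right.mp hUX)

/-- Decompositions of the factors of a decomposition combine to a finer decomposition. -/
theorem Decomposes.biUnion {S : Set L} {Y : L} (h : Decomposes S Y) {T : L → Set L}
    (hT : ∀ X ∈ S, Decomposes (T X) X) : Decomposes (⋃ X ∈ S, T X) Y where
  le := by
    intro V hV
    obtain ⟨X, hX, hV⟩ := Set.mem_iUnion₂.mp hV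
    exact ((hT X hX).le V hV).trans (h.le X hX)
  le_of_inf_le := by
    intro W hW U hU
    refine h.le_of_inf_le W hW U fun X hX => ?_
    refine (hT X hX).le_of_inf_le _ inf_le_right U fun V hV => ?_
    exact (inf_le_inf_right V inf_le_left).trans (hU V (Set.mem_biUnion hX hV))
  exists_inf_eq := by
    intro t ht
    have hex : ∀ X, ∃ U, X ∈ S → U ≤ X ∧ ∀ V ∈ T X, U ⊓ V = t V := by
      intro X
      by_cases hX : X ∈ S
      · obtain ⟨U, hUX, hU⟩ := (hT X hX).exists_inf_eq t
          fun V hV => ht V (Set.mem_biUnion hX hV)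
        exact ⟨U, fun _ => ⟨hUX, hU⟩⟩
      · exact ⟨⊥, fun hX' => absurd hX' hX⟩
    choose u hu using hex
    obtain ⟨U, hUY, hU⟩ := h.exists_inf_eq u fun X hX => (hu X hX).1
    refine ⟨U, hUY, fun V hV => ?_⟩
    obtain ⟨X, hX, hV⟩ := Set.mem_iUnion₂.mp hV
    rw [← (hu X hX).2 V hV, ← hU X hX, inf_assoc, inf_eq_right.mpr ((hT X hX).le V hV)]

theorem hasFactorization_iff_decomposes {B : Set L} {Y : L} :
    HasFactorization B Y ↔ Decomposes (maxBelow B Y) Y := by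
  classical
  constructor
  · rintro ⟨φ, hφ⟩
    have hle : ∀ (W : Set.Iic Y) (X : maxBelow B Y) (z : L), z ≤ X →
        (z ≤ (φ.symm W).val X ↔ z ≤ W) := by
      intro W X z hz
      let s : {t : maxBelow B Y → L // ∀ X, t X ≤ (X : L)} :=
        ⟨Function.update (fun _ => ⊥) X z, fun X' => by
          by_cases hX : X' = X
          · subst hX; simpa using hz
          · simp [hX]⟩
      have hs : (φ s : L) = z := by
        rw [hφ s X fun X' hX' => by simp [s, hX']]
        simp [s]
      have hsW : s ≤ φ.symm W ↔ z ≤ (φ.symm W).val X := by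
        rw [← Subtype.coe_le_coe]
        simp [s, update_le_iff]
      rw [← hsW, OrderIso.le_symm_apply, ← Subtype.coe_le_coe, hs]
    have hsymm : ∀ (W : Set.Iic Y) (X : maxBelow B Y), (φ.symm W).val X = (W : L) ⊓ X := by
      intro W X
      refine le_antisymm (le_inf ?_ ((φ.symm W).2 X)) ?_
      · exact (hle W X _ ((φ.symm W).2 X)).mp le_rfl
      · exact (hle W X _ inf_le_right).mpr inf_le_left
    refine ⟨fun X hX => hX.2.1, fun W hW U hU => ?_, fun t ht => ?_⟩
    · have h : φ.symm ⟨W, hW⟩ ≤ φ.symm ⟨U ⊓ Y, inf_le_right⟩ := by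
        intro X
        rw [hsymm, hsymm]
        exact le_inf (le_inf (hU X X.2) (inf_le_left.trans hW)) inf_le_right
      exact (Subtype.coe_le_coe.mpr (φ.symm.le_iff_le.mp h)).trans inf_le_left
    · refine ⟨φ ⟨fun X => t X, fun X => ht X X.2⟩, (φ _).2, fun X hX => ?_⟩
      rw [← hsymm _ ⟨X, hX⟩, OrderIso.symm_apply_apply]
  · intro h
    let ψ : Set.Iic Y ↪o {t : maxBelow B Y → L // ∀ X, t X ≤ (X : L)} :=
      OrderEmbedding.ofMapLEIff (fun W => ⟨fun X => (W : L) ⊓ X, fun _ => inf_le_right⟩) (by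
        intro W U
        constructor
        · intro hWU
          exact h.le_of_inf_le W W.2 U fun X hX => (hWU ⟨X, hX⟩).trans inf_le_left
        · exact fun hWU X => inf_le_inf_right _ hWU)
    have hψ : Function.Surjective ψ := by
      rintro ⟨t, ht⟩
      obtain ⟨U, hUY, hU⟩ := h.exists_inf_eq
        (fun X => if hX : X ∈ maxBelow B Y then t ⟨X, hX⟩ else ⊥)
        (fun X hX => by simpa [hX] using ht ⟨X, hX⟩)
      refine ⟨⟨U, hUY⟩, Subtype.ext (funext fun X => ?_)⟩
      exact (hU X X.2).trans (dif_pos X.2)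
    let e := RelIso.ofSurjective ψ hψ
    refine ⟨e.symm, fun t X ht => ?_⟩
    have hinf : ∀ X' : maxBelow B Y, (e.symm t : L) ⊓ X' = t.val X' := fun X' =>
      congrFun (congrArg Subtype.val (e.apply_symm_apply t)) X'
    refine le_antisymm (h.le_of_inf_le _ (e.symm t).2 _ fun X' hX' => ?_) ?_
    · rw [hinf ⟨X', hX'⟩]
      by_cases hne : (⟨X', hX'⟩ : maxBelow B Y) = X
      · rw [hne]
      · rw [ht _ hne]
        exact bot_le
    · rw [← hinf X]
      exact inf_le_left

theorem maxBelow_bot {D : Set L} (hD : ⊥ ∉ D) : maxBelow D ⊥ = ∅ := by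
  ext X
  simp only [Set.mem_empty_iff_false, iff_false]
  rintro ⟨hX, hle, -⟩
  exact hD (le_bot_iff.mp hle ▸ hX)

theorem maxBelow_eq_biUnion {D S : Set L} {Y : L} (hD : ⊥ ∉ D) (h : Decomposes S Y)
    (hS : ∀ E ∈ D, E ≤ Y → ∃ X ∈ S, E ≤ X) :
    maxBelow D Y = ⋃ X ∈ S, maxBelow D X := by
  ext V
  simp only [Set.mem_iUnion₂]
  constructor
  · rintro ⟨hV, hVY, hmax⟩
    obtain ⟨X, hX, hVX⟩ := hS V hV hVY
    exact ⟨X, hX, hV, hVX, fun E hE hEX => hmax E hE (hEX.trans (h.le X hX))⟩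
  · rintro ⟨X, hX, hV, hVX, hmax⟩
    refine ⟨hV, hVX.trans (h.le X hX), fun E hE hEY hVE => ?_⟩
    obtain ⟨X', hX', hEX'⟩ := hS E hE hEY
    obtain rfl | hne := eq_or_ne X X'
    · exact hmax E hE hEX' hVE
    · have hV_bot : V ≤ ⊥ := by
        rw [← h.inf_eq_bot hX hX' hne]
        exact le_inf hVX (hVE.trans hEX')
      exact absurd (le_bot_iff.mp hV_bot ▸ hV) hD

/-- A set is building as soon as every interval `[⊥, Z]` with `Z` outside of it has a proper
decomposition such that every element of the set below `Z` lies below one of the factors. -/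
theorem isLatBuilding_of_exists_decomposes [Finite L] {D : Set L} (hD : ⊥ ∉ D)
    (h : ∀ Z, Z ≠ ⊥ → Z ∉ D →
      ∃ S, Decomposes S Z ∧ Z ∉ S ∧ ∀ E ∈ D, E ≤ Z → ∃ X ∈ S, E ≤ X) :
    IsLatBuilding D := by
  refine ⟨hD, fun Y hY => hasFactorization_iff_decomposes.mpr ?_⟩
  clear hY
  induction Y using WellFoundedLT.induction with
  | _ Y ih =>
    obtain rfl | hY := eq_or_ne Y ⊥
    · rw [maxBelow_bot hD]
      exact decomposes_empty_bot
    by_cases hYD : Y ∈ D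
    · rw [maxBelow_of_mem hYD]
      exact decomposes_singleton Y
    obtain ⟨S, hS, hYS, hDS⟩ := h Y hY hYD
    rw [maxBelow_eq_biUnion hD hS hDS]
    exact hS.biUnion fun X hX =>
      ih X ((hS.le X hX).lt_of_ne fun hXY => hYS (hXY ▸ hX))

theorem IsLatBuilding.exists_decomposes [Finite L] {B D : Set L} (hB : IsLatBuilding B)
    (hDB : D ⊆ B) {Z : L} (hZ : Z ≠ ⊥) (hZB : Z ∉ B) :
    ∃ S, Decomposes S Z ∧ Z ∉ S ∧ ∀ E ∈ D, E ≤ Z → ∃ X ∈ S, E ≤ X :=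
  ⟨maxBelow B Z, hasFactorization_iff_decomposes.mp (hB.2 Z (bot_lt_iff_ne_bot.mpr hZ)),
    fun hmem => hZB hmem.1, fun _ hE hEZ => exists_le_mem_maxBelow (hDB hE) hEZ⟩

/-- The nonbottom elements common to a family of building sets form a building set. -/
theorem isLatBuilding_sInter_diff_bot [Finite L] {F : Set (Set L)}
    (hF : ∀ B ∈ F, IsLatBuilding B) : IsLatBuilding (⋂₀ F \ {⊥}) := by
  refine isLatBuilding_of_exists_decomposes (by simp) fun Z hZ hZF => ?_
  obtain ⟨B, hB, hZB⟩ : ∃ B ∈ F, Z ∉ B := by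
    by_contra! hcon
    exact hZF ⟨hcon, hZ⟩
  exact (hF B hB).exists_decomposes (fun E hE => hE.1 B hB) hZ hZB

/-- Removing from a building set those elements below `Y` that lie below no factor of a
decomposition of `[⊥, Y]` leaves a building set. -/
theorem IsLatBuilding.sep_of_decomposes [Finite L] {C S : Set L} {Y : L}
    (hC : IsLatBuilding C) (hS : Decomposes S Y) :
    IsLatBuilding {Z ∈ C | Z ≤ Y → ∃ X ∈ S, Z ≤ X} := by
  refine isLatBuilding_of_exists_decomposes (fun h => hC.1 h.1) fun Z hZ hZD => ?_
  by_cases hZC : Z ∈ C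
  · obtain ⟨hZY, hZS⟩ : Z ≤ Y ∧ ∀ X ∈ S, ¬ Z ≤ X := by
      by_contra! hcon
      exact hZD ⟨hZC, hcon⟩
    refine ⟨_, hS.restrict hZY, ?_, ?_⟩
    · rintro ⟨X, hX, hZX⟩
      exact hZS X hX (inf_eq_left.mp hZX)
    · rintro E ⟨-, hE⟩ hEZ
      obtain ⟨X, hX, hEX⟩ := hE (hEZ.trans hZY)
      exact ⟨Z ⊓ X, ⟨X, hX, rfl⟩, le_inf hEZ hEX⟩
  · exact hC.exists_decomposes (fun E hE => hE.1) hZ hZC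

end Decomposition

/-- **Building closure.** For a finite lattice `L` and a family `𝓧 ⊆ L∖{⊥}`, the collection of
`L`-building sets containing `𝓧` has a unique inclusion-minimal (i.e. least) element, the
building closure of `𝓧`; moreover every element `Y` of the building closure that is not in `𝓧`
is such that there is no order isomorphism from `∏_{X ∈ max(𝓧_{≤Y})} L_{≤X}` onto `L_{≤Y}`
whose components are the interval inclusions. -/
theorem building_closure {L : Type*} [Lattice L] [BoundedOrder L] [Fintype L]
    (𝓧 : Set L) (h𝓧 : (⊥ : L) ∉ 𝓧) :
    (∃! C : Set L, IsLatBuilding C ∧ 𝓧 ⊆ C ∧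
        ∀ B : Set L, IsLatBuilding B → 𝓧 ⊆ B → C ⊆ B) ∧
    (∀ C : Set L,
        (IsLatBuilding C ∧ 𝓧 ⊆ C ∧ ∀ B : Set L, IsLatBuilding B → 𝓧 ⊆ B → C ⊆ B) →
        ∀ Y ∈ C \ 𝓧, ¬ HasFactorization 𝓧 Y) := by
  constructor
  · refine ⟨⋂₀ {B | IsLatBuilding B ∧ 𝓧 ⊆ B} \ {⊥}, ⟨?_, ?_, ?_⟩, ?_⟩
    · exact isLatBuilding_sInter_diff_bot fun B hB => hB.1
    · exact fun X hX => ⟨fun B hB => hB.2 hX, fun hbot => h𝓧 (hbot ▸ hX)⟩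
    · exact fun B hB h𝓧B X hX => hX.1 B ⟨hB, h𝓧B⟩
    · rintro C ⟨hC, h𝓧C, hmin⟩
      refine Set.Subset.antisymm (fun X hX => ⟨fun B hB => hmin B hB.1 hB.2 hX, ?_⟩)
        fun X hX => hX.1 C ⟨hC, h𝓧C⟩
      exact fun hbot => hC.1 (hbot ▸ hX)
  · rintro C ⟨hC, h𝓧C, hmin⟩ Y ⟨hYC, hY𝓧⟩ hfac
    have hD := hC.sep_of_decomposes (hasFactorization_iff_decomposes.mp hfac)
    obtain ⟨X, hX, hYX⟩ :=
      (hmin _ hD (fun Z hZ => ⟨h𝓧C hZ, exists_le_mem_maxBelow hZ⟩) hYC).2 le_rfl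
    exact hY𝓧 (le_antisymm hYX hX.2.1 ▸ hX.1)
end

section
/- Let L be a finite lattice, 𝓑 an L-building set, and X ∈ 𝓑∖𝓒(𝓑). Then the map N ↦ (N_{≤X}, {B ∨ X : B ∈ N, B ≰ X}) is a bijection from the set of L-nested sets on 𝓑 that contain X onto the set of pairs (N₁, N₂) where N₁ is an L_{≤X}-nested set on the restriction 𝓑_{|X} := {B ∈ 𝓑 : B ≤ X} and N₂ is an L_{≥X}-nested set on the contraction 𝓑_{/X} := {B ∨ X : B ∈ 𝓑, B ≰ X}. In particular, the link of {X} in the L-nested complex of 𝓑 is isomorphic to the join of the nested complexes of 𝓑_{|X} and 𝓑_{/X}. -/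
section LatticePrelims

variable {L : Type*} [Lattice L] [BoundedOrder L]

/-- The connected components (i.e. the inclusion-maximal elements) of `B`. -/
def latConn (B : Set L) : Set L :=
  {X | X ∈ B ∧ ∀ Z ∈ B, X ≤ Z → X = Z}

/-- `N` is an `L`-nested set on the building set `B`: a subset of `B` containing the connected
components of `B` such that the join of any `k ≥ 2` pairwise incomparable elements of
`N ∖ latConn B` does not belong to `B`. -/
def IsLatNested (B N : Set L) : Prop :=
  N ⊆ B ∧ latConn B ⊆ N ∧
    ∀ A : Finset L, ↑A ⊆ N \ latConn B → 2 ≤ A.card →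
      (↑A : Set L).Pairwise (fun x y => ¬ x ≤ y ∧ ¬ y ≤ x) → A.sup id ∉ B

end LatticePrelims

section JoinPrime

variable {L : Type*} [Lattice L]

theorem exists_mem_maxBelow [Finite L] {B : Set L} {b Y : L} (hb : b ∈ B) (hbY : b ≤ Y) :
    ∃ m ∈ maxBelow B Y, b ≤ m := by
  obtain ⟨m, hbm, hm⟩ := (Set.toFinite {Z | Z ∈ B ∧ Z ≤ Y}).exists_le_maximal ⟨hb, hbY⟩
  exact ⟨m, ⟨hm.prop.1, hm.prop.2, fun Z hZ hZY h => le_antisymm h (hm.2 ⟨hZ, hZY⟩ h)⟩, hbm⟩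

variable [BoundedOrder L]

/-- Every element of `B` below a finite join of elements of `B` lies below a subjoin belonging
to `B`. -/
def RefinesJoins (B : Set L) : Prop :=
  ∀ A : Finset L, ↑A ⊆ B → ∀ b ∈ B, b ≤ A.sup id → ∃ A' ⊆ A, b ≤ A'.sup id ∧ A'.sup id ∈ B

/-- The elements of `B` are join-prime with respect to finite joins of elements of `N`. -/
def JoinPrimeOn (B N : Set L) : Prop :=
  ∀ A : Finset L, ↑A ⊆ N → ∀ b ∈ B, b ≤ A.sup id → ∃ a ∈ A, b ≤ a

theorem exists_mem_latConn [Finite L] {B : Set L} {b : L} (hb : b ∈ B) :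
    ∃ c ∈ latConn B, b ≤ c := by
  obtain ⟨c, hc, hbc⟩ := exists_mem_maxBelow hb (le_top (a := b))
  exact ⟨c, ⟨hc.1, fun Z hZ h => hc.2.2 Z hZ le_top h⟩, hbc⟩

theorem IsLatBuilding.refinesJoins [Finite L] {B : Set L} (hB : IsLatBuilding B) :
    RefinesJoins B := by
  classical
  intro A hA b hb hbA
  have hbot : ⊥ < A.sup id :=
    lt_of_lt_of_le (bot_lt_iff_ne_bot.2 fun h => hB.1 (h ▸ hb)) hbA
  obtain ⟨φ, hφ⟩ := hB.2 _ hbot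
  obtain ⟨m, hm, hbm⟩ := exists_mem_maxBelow hb hbA
  set s : L := (A.filter (· ≤ m)).sup id
  have hsm : s ≤ m := Finset.sup_le fun a ha => (Finset.mem_filter.1 ha).2
  have below (t : {t : maxBelow B (A.sup id) → L // ∀ Z, t Z ≤ (Z : L)})
      (Z : maxBelow B (A.sup id)) : t.val Z ≤ (φ t : L) := by
    let e : {t : maxBelow B (A.sup id) → L // ∀ Z, t Z ≤ (Z : L)} :=
      ⟨Function.update (fun _ => ⊥) Z (t.val Z), fun W => by
        by_cases h : W = Z
        · subst h; simpa using t.2 W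
        · simp [h]⟩
    have he : (φ e : L) = t.val Z := by
      rw [hφ e Z fun W hW => by simp [e, hW]]
      simp [e]
    have het : e ≤ t := fun W => by
      by_cases h : W = Z
      · subst h; simp [e]
      · simp [e, h]
    rw [← he]
    exact φ.monotone het
  let t : {t : maxBelow B (A.sup id) → L // ∀ Z, t Z ≤ (Z : L)} :=
    ⟨Function.update (fun Z => (Z : L)) ⟨m, hm⟩ s, fun W => by
      by_cases h : W = ⟨m, hm⟩
      · subst h; simpa using hsm
      · simp [h]⟩
  have ht : A.sup id ≤ (φ t : L) := Finset.sup_le fun a ha => by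
    obtain ⟨m', hm', ham'⟩ := exists_mem_maxBelow (hA ha) (Finset.le_sup (f := id) ha)
    refine le_trans ?_ (below t ⟨m', hm'⟩)
    by_cases h : m' = m
    · subst h
      simpa [t] using Finset.le_sup (f := id) (Finset.mem_filter.2 ⟨ha, ham'⟩)
    · simpa [t, h] using ham'
  have hle : (⟨fun Z => (Z : L), fun _ => le_rfl⟩ :
      {t : maxBelow B (A.sup id) → L // ∀ Z, t Z ≤ (Z : L)}) ≤ t :=
    φ.le_iff_le.1 (show (φ _ : L) ≤ φ t from le_trans (Set.mem_Iic.1 (φ _).2) ht)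
  have hms : m ≤ s := by simpa [t] using hle ⟨m, hm⟩
  exact ⟨A.filter (· ≤ m), Finset.filter_subset _ _, hbm.trans hms,
    (le_antisymm hms hsm).subst (motive := (· ∈ B)) hm.1⟩

theorem Finset.exists_antichain_sup_eq (A : Finset L) :
    ∃ A' ⊆ A, A'.sup id = A.sup id ∧
      (↑A' : Set L).Pairwise (fun x y => ¬ x ≤ y ∧ ¬ y ≤ x) := by
  classical
  induction A using Finset.strongInduction with
  | H A ih =>
    by_cases h : (↑A : Set L).Pairwise (fun x y => ¬ x ≤ y ∧ ¬ y ≤ x)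
    · exact ⟨A, subset_rfl, rfl, h⟩
    · have : ∃ x ∈ A, ∃ y ∈ A, x ≠ y ∧ x ≤ y := by
        simp only [Set.Pairwise, not_forall] at h
        obtain ⟨x, hx, y, hy, hne, hxy⟩ := h
        by_cases hle : x ≤ y
        · exact ⟨x, hx, y, hy, hne, hle⟩
        · exact ⟨y, hy, x, hx, hne.symm, by tauto⟩
      obtain ⟨x, hx, y, hy, hne, hxy⟩ := this
      obtain ⟨A', hA', hsup, hanti⟩ := ih _ (Finset.erase_ssubset hx)
      refine ⟨A', hA'.trans (Finset.erase_subset _ _), hsup.trans ?_, hanti⟩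
      refine le_antisymm (Finset.sup_mono (Finset.erase_subset _ _)) (Finset.sup_le fun a ha => ?_)
      by_cases hax : a = x
      · subst hax
        exact hxy.trans (Finset.le_sup (f := id) (Finset.mem_erase.2 ⟨hne.symm, hy⟩))
      · exact Finset.le_sup (f := id) (Finset.mem_erase.2 ⟨hax, ha⟩)

theorem IsLatNested.joinPrimeOn {B N : Set L} (hN : IsLatNested B N) (hbot : ⊥ ∉ B)
    (hB : RefinesJoins B) : JoinPrimeOn B N := by
  intro A hA b hb hbA
  obtain ⟨A₁, hA₁, hbA₁, hmem⟩ := hB A (hA.trans hN.1) b hb hbA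
  obtain ⟨A₂, hA₂, hsup, hanti⟩ := A₁.exists_antichain_sup_eq
  rw [← hsup] at hbA₁ hmem
  have hsub : (↑A₂ : Set L) ⊆ N := fun a ha => hA (hA₁ (hA₂ ha))
  rcases Nat.lt_or_ge A₂.card 2 with hcard | hcard
  · rcases A₂.eq_empty_or_nonempty with rfl | ⟨a, ha⟩
    · exact absurd (by simpa using hmem) hbot
    · obtain rfl : A₂ = {a} :=
        Finset.eq_singleton_iff_unique_mem.2
          ⟨ha, fun x hx => Finset.card_le_one.1 (by omega) x hx a ha⟩
      exact ⟨a, hA₁ (hA₂ ha), by simpa using hbA₁⟩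
  · refine absurd hmem (hN.2.2 A₂ (fun a ha => ⟨hsub ha, fun hac => ?_⟩) hcard hanti)
    obtain ⟨c, hc, hca⟩ := Finset.exists_mem_ne hcard a
    refine (hanti hc ha hca).1 ?_
    rw [hac.2 _ hmem (Finset.le_sup (f := id) ha)]
    exact Finset.le_sup (f := id) hc

theorem JoinPrimeOn.isLatNested {B N : Set L} (hP : JoinPrimeOn B N) (hsub : N ⊆ B)
    (hconn : latConn B ⊆ N) : IsLatNested B N := by
  refine ⟨hsub, hconn, fun A hA hcard hanti hmem => ?_⟩
  obtain ⟨a, ha, hle⟩ := hP A (fun x hx => (hA hx).1) _ hmem le_rfl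
  obtain ⟨c, hc, hca⟩ := Finset.exists_mem_ne hcard a
  exact (hanti hc ha hca).1 ((Finset.le_sup (f := id) hc).trans hle)

theorem JoinPrimeOn.le_or_le {B N : Set L} (hP : JoinPrimeOn B N) {a x b : L} (ha : a ∈ N)
    (hx : x ∈ N) (hb : b ∈ B) (h : b ≤ a ⊔ x) : b ≤ a ∨ b ≤ x := by
  classical
  obtain ⟨c, hc, hbc⟩ := hP {a, x} (by simp [Set.insert_subset_iff, ha, hx]) b hb (by simpa using h)
  simp only [Finset.mem_insert, Finset.mem_singleton] at hc
  rcases hc with rfl | rfl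
  · exact Or.inl hbc
  · exact Or.inr hbc

theorem RefinesJoins.le_or_le_or_sup_mem {B : Set L} (hB : RefinesJoins B) {a x b : L}
    (ha : a ∈ B) (hx : x ∈ B) (hb : b ∈ B) (h : b ≤ a ⊔ x) :
    b ≤ a ∨ b ≤ x ∨ a ⊔ x ∈ B := by
  classical
  obtain ⟨A, hA, hbA, hmem⟩ :=
    hB {a, x} (by simp [Set.insert_subset_iff, ha, hx]) b hb (by simpa using h)
  by_cases haA : a ∈ A
  · by_cases hxA : x ∈ A
    · obtain rfl : A = {a, x} :=
        hA.antisymm (by simp [Finset.insert_subset_iff, haA, hxA])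
      exact Or.inr (Or.inr (by simpa using hmem))
    · refine Or.inl (hbA.trans (Finset.sup_le fun z hz => ?_))
      have := hA hz
      simp only [Finset.mem_insert, Finset.mem_singleton] at this
      rcases this with rfl | rfl
      · exact le_rfl
      · exact absurd hz hxA
  · refine Or.inr (Or.inl (hbA.trans (Finset.sup_le fun z hz => ?_)))
    have := hA hz
    simp only [Finset.mem_insert, Finset.mem_singleton] at this
    rcases this with rfl | rfl
    · exact absurd hz haA
    · exact le_rfl

end JoinPrime

section RestrictionContraction

variable {L : Type*} [Lattice L]

/-- The restriction of `B` to the interval `[⊥, X]`. -/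
abbrev latRestrict (B : Set L) (X : L) : Set (Set.Iic X) :=
  {Z : Set.Iic X | (Z : L) ∈ B}

/-- The contraction of `B` to the interval `[X, ⊤]`. -/
abbrev latContract (B : Set L) (X : L) : Set (Set.Ici X) :=
  {Z : Set.Ici X | ∃ b ∈ B, ¬ b ≤ X ∧ (Z : L) = b ⊔ X}

theorem bot_notMem_latContract (B : Set L) (X : L) : ⊥ ∉ latContract B X := by
  rintro ⟨b, -, hbX, h⟩
  exact hbX (le_sup_left.trans h.symm.le)

theorem mem_latConn_latRestrict_iff {B : Set L} {X : L} (hX : X ∈ B) {z : Set.Iic X} :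
    z ∈ latConn (latRestrict B X) ↔ (z : L) = X := by
  refine ⟨fun h => congrArg Subtype.val (h.2 ⟨X, le_rfl⟩ hX z.2), fun h => ⟨?_, fun w _ hw => ?_⟩⟩
  · change (z : L) ∈ B
    rwa [h]
  · exact le_antisymm hw (show (w : L) ≤ z from h.symm ▸ Set.mem_Iic.1 w.2)

/-- The elements of `B` in the nested set glued from `N₁` on the restriction and `N₂` on the
contraction of `B` at `X`. -/
def latGlue (B : Set L) {X : L} (N₁ : Set (Set.Iic X)) (N₂ : Set (Set.Ici X)) : Set L :=
  {b | b ∈ B ∧ ((∃ z ∈ N₁, (z : L) = b) ∨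
    ¬ b ≤ X ∧ ∃ z ∈ N₂, (z : L) = b ⊔ X ∧ ((z : L) ∈ B → b = z))}

theorem latRestrict_latGlue {B : Set L} {X : L} {N₁ : Set (Set.Iic X)} {N₂ : Set (Set.Ici X)}
    (h₁ : N₁ ⊆ latRestrict B X) : latRestrict (latGlue B N₁ N₂) X = N₁ := by
  ext z
  constructor
  · rintro ⟨-, ⟨y, hy, hyz⟩ | ⟨hzX, -⟩⟩
    · exact Subtype.ext hyz ▸ hy
    · exact absurd z.2 hzX
  · exact fun hz => ⟨h₁ hz, Or.inl ⟨z, hz, rfl⟩⟩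

theorem latContract_latGlue {B : Set L} {X : L} {N₁ : Set (Set.Iic X)} {N₂ : Set (Set.Ici X)}
    (h₂ : N₂ ⊆ latContract B X) : latContract (latGlue B N₁ N₂) X = N₂ := by
  ext z
  constructor
  · rintro ⟨b, ⟨-, ⟨y, -, rfl⟩ | ⟨-, w, hw, hwb, -⟩⟩, hbX, hzb⟩
    · exact absurd y.2 hbX
    · exact Subtype.ext (hwb.trans hzb.symm) ▸ hw
  · intro hz
    obtain ⟨b, hb, hbX, hzb⟩ := h₂ hz
    by_cases hzB : (z : L) ∈ B
    · have hzX : ¬ (z : L) ≤ X := fun h => hbX ((le_sup_left.trans hzb.symm.le).trans h)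
      have hzz : (z : L) = (z : L) ⊔ X := (sup_eq_left.2 z.2).symm
      exact ⟨z, ⟨hzB, Or.inr ⟨hzX, z, hz, hzz, fun _ => rfl⟩⟩, hzX, hzz⟩
    · exact ⟨b, ⟨hb, Or.inr ⟨hbX, z, hz, hzb, fun h => absurd h hzB⟩⟩, hbX, hzb⟩

variable [BoundedOrder L]

theorem Set.Iic.coe_finset_sup [DecidableEq L] {X : L} (A : Finset (Set.Iic X)) :
    ((A.sup id : Set.Iic X) : L) = (A.image Subtype.val).sup id := by
  induction A using Finset.induction with
  | empty => rfl
  | insert a A _ ih => rw [Finset.image_insert, Finset.sup_insert, Finset.sup_insert, ← ih]; rfl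

/-- Finite joins in `[X, ⊤]` of elements `b ⊔ X` with `b ∈ N` are bounded by finite joins of
elements of `N` and `X`. -/
theorem exists_finset_le_sup [Finite L] {N : Set L} {X : L} {A : Finset (Set.Ici X)}
    (hA : ↑A ⊆ latContract N X) :
    ∃ A' : Finset L, (∀ a ∈ A', a ∈ N ∧ ¬ a ≤ X ∧ ∃ z ∈ A, (z : L) = a ⊔ X) ∧
      ((A.sup id : Set.Ici X) : L) ≤ A'.sup id ⊔ X := by
  classical
  have := Fintype.ofFinite L
  refine ⟨Finset.univ.filter fun a => a ∈ N ∧ ¬ a ≤ X ∧ ∃ z ∈ A, (z : L) = a ⊔ X, by simp, ?_⟩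
  refine Finset.sup_le (a := (⟨_, le_sup_right⟩ : Set.Ici X)) fun z hz => ?_
  obtain ⟨a, ha, haX, hza⟩ := hA hz
  change (z : L) ≤ _
  rw [hza]
  refine sup_le_sup_right (Finset.le_sup (f := id) ?_) X
  simp only [Finset.mem_filter, Finset.mem_univ, true_and]
  exact ⟨ha, haX, z, hz, hza⟩

theorem JoinPrimeOn.restrict {B N : Set L} (hP : JoinPrimeOn B N) (X : L) :
    JoinPrimeOn (latRestrict B X) (latRestrict N X) := by
  classical
  intro A hA b hb hbA
  obtain ⟨a, ha, hba⟩ := hP (A.image Subtype.val)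
    (by intro x hx; obtain ⟨y, hy, rfl⟩ := Finset.mem_image.1 hx; exact hA hy) b hb (by
      rw [← Set.Iic.coe_finset_sup]
      exact hbA)
  obtain ⟨y, hy, rfl⟩ := Finset.mem_image.1 ha
  exact ⟨y, hy, hba⟩

theorem RefinesJoins.restrict {B : Set L} (hB : RefinesJoins B) (X : L) :
    RefinesJoins (latRestrict B X) := by
  classical
  intro A hA b hb hbA
  obtain ⟨A', hA', hbA', hmem⟩ := hB (A.image Subtype.val)
    (by intro x hx; obtain ⟨y, hy, rfl⟩ := Finset.mem_image.1 hx; exact hA hy) b hb (by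
      rw [← Set.Iic.coe_finset_sup]
      exact hbA)
  obtain ⟨A'', hA'', rfl⟩ := Finset.subset_image_iff.1 hA'
  have heq : ((A''.sup id : Set.Iic X) : L) = (A''.image Subtype.val).sup id :=
    Set.Iic.coe_finset_sup A''
  refine ⟨A'', hA'', ?_, ?_⟩
  · change (b : L) ≤ (A''.sup id : Set.Iic X)
    rwa [heq]
  · change ((A''.sup id : Set.Iic X) : L) ∈ B
    rwa [heq]

theorem JoinPrimeOn.contract [Finite L] {B N : Set L} {X : L} (hP : JoinPrimeOn B N)
    (hX : X ∈ N) : JoinPrimeOn (latContract B X) (latContract N X) := by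
  classical
  rintro A hA z ⟨b, hb, hbX, hzb⟩ hbA
  obtain ⟨A', hA', hle⟩ := exists_finset_le_sup hA
  have hzA : (z : L) ≤ (A.sup id : Set.Ici X) := hbA
  obtain ⟨a, ha, hba⟩ := hP (insert X A')
    (by
      intro x hx
      rcases Finset.mem_insert.1 hx with rfl | hx
      · exact hX
      · exact (hA' x hx).1) b hb (by
      rw [Finset.sup_insert, sup_comm]
      exact (le_sup_left.trans hzb.symm.le).trans (hzA.trans hle))
  rcases Finset.mem_insert.1 ha with rfl | ha
  · exact absurd hba hbX
  · obtain ⟨-, -, w, hw, hwa⟩ := hA' a ha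
    refine ⟨w, hw, ?_⟩
    change (z : L) ≤ w
    rw [hzb, hwa]
    exact sup_le_sup_right hba X

theorem RefinesJoins.contract [Finite L] {B : Set L} {X : L} (hB : RefinesJoins B)
    (hX : X ∈ B) : RefinesJoins (latContract B X) := by
  classical
  rintro A hA z ⟨b, hb, hbX, hzb⟩ hbA
  obtain ⟨A', hA', hle⟩ := exists_finset_le_sup hA
  have hzA : (z : L) ≤ (A.sup id : Set.Ici X) := hbA
  obtain ⟨A₁, hA₁, hbA₁, hmem⟩ := hB (insert X A')
    (by
      intro x hx
      rcases Finset.mem_insert.1 hx with rfl | hx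
      · exact hX
      · exact (hA' x hx).1) b hb (by
      rw [Finset.sup_insert, sup_comm]
      exact (le_sup_left.trans hzb.symm.le).trans (hzA.trans hle))
  set A₂ : Finset (Set.Ici X) := A.filter fun w => ∃ a ∈ A₁, (w : L) = a ⊔ X
  have heq : ((A₂.sup id : Set.Ici X) : L) = A₁.sup id ⊔ X := by
    refine le_antisymm ?_ (sup_le (Finset.sup_le fun a ha => ?_) (A₂.sup id).2)
    · refine Finset.sup_le (a := (⟨_, le_sup_right⟩ : Set.Ici X)) fun w hw => ?_
      obtain ⟨-, a, ha, hwa⟩ := Finset.mem_filter.1 hw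
      change (w : L) ≤ _
      rw [hwa]
      exact sup_le_sup_right (Finset.le_sup (f := id) ha) X
    · rcases Finset.mem_insert.1 (hA₁ ha) with rfl | ha'
      · exact (A₂.sup id).2
      · obtain ⟨-, -, w, hw, hwa⟩ := hA' a ha'
        have hw₂ : w ≤ A₂.sup id :=
          Finset.le_sup (f := id) (Finset.mem_filter.2 ⟨hw, a, ha, hwa⟩)
        exact (le_sup_left.trans hwa.symm.le).trans hw₂
  refine ⟨A₂, Finset.filter_subset _ _, ?_, A₁.sup id, hmem, fun h => hbX (hbA₁.trans h), heq⟩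
  change (z : L) ≤ (A₂.sup id : Set.Ici X)
  rw [heq, hzb]
  exact sup_le_sup_right hbA₁ X

theorem le_of_sup_mem_imp {B : Set L} (hB : RefinesJoins B) {X a b : L} (hX : X ∈ B)
    (ha : a ∈ B) (hb : b ∈ B) (hbX : ¬ b ≤ X) (h : b ≤ a ⊔ X) (haX : a ⊔ X ∈ B → a = a ⊔ X) :
    b ≤ a := by
  rcases hB.le_or_le_or_sup_mem ha hX hb h with h' | h' | h'
  · exact h'
  · exact absurd h' hbX
  · rwa [haX h']

theorem joinPrimeOn_latGlue {B : Set L} (hB : RefinesJoins B) {X : L} (hX : X ∈ B)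
    {N₁ : Set (Set.Iic X)} {N₂ : Set (Set.Ici X)} (h₁ : JoinPrimeOn (latRestrict B X) N₁)
    (h₂ : JoinPrimeOn (latContract B X) N₂) : JoinPrimeOn B (latGlue B N₁ N₂) := by
  classical
  have not_le (A : Finset L) (hA : ↑A ⊆ latGlue B N₁ N₂) (b : L) (hb : b ∈ B)
      (hbA : b ≤ A.sup id) (hbX : ¬ b ≤ X) : ∃ a ∈ A, b ≤ a := by
    set A' : Finset (Set.Ici X) :=
      (A.filter fun a => ¬ a ≤ X).image fun a => ⟨a ⊔ X, le_sup_right⟩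
    have hsub : (↑A' : Set (Set.Ici X)) ⊆ N₂ := by
      intro w hw
      obtain ⟨a, ha, rfl⟩ := Finset.mem_image.1 hw
      obtain ⟨haA, haX⟩ := Finset.mem_filter.1 ha
      obtain ⟨-, ⟨y, -, rfl⟩ | ⟨-, z, hz, hza, -⟩⟩ := hA haA
      · exact absurd y.2 haX
      · convert hz
        exact Subtype.ext hza.symm
    have hle : A.sup id ≤ (A'.sup id : Set.Ici X) := Finset.sup_le fun a ha => by
      by_cases haX : a ≤ X
      · exact haX.trans (A'.sup id).2
      · have : (⟨a ⊔ X, le_sup_right⟩ : Set.Ici X) ≤ A'.sup id :=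
          Finset.le_sup (f := id)
            (Finset.mem_image.2 ⟨a, Finset.mem_filter.2 ⟨ha, haX⟩, rfl⟩)
        exact le_sup_left.trans (show a ⊔ X ≤ (A'.sup id : Set.Ici X) from this)
    obtain ⟨w, hw, hbw⟩ := h₂ A' hsub ⟨b ⊔ X, le_sup_right⟩ ⟨b, hb, hbX, rfl⟩
      (show b ⊔ X ≤ (A'.sup id : Set.Ici X) from sup_le (hbA.trans hle) (A'.sup id).2)
    obtain ⟨a, ha, rfl⟩ := Finset.mem_image.1 hw
    obtain ⟨haA, haX⟩ := Finset.mem_filter.1 ha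
    refine ⟨a, haA, ?_⟩
    obtain ⟨haB, ⟨y, -, rfl⟩ | ⟨-, z, -, hza, hzB⟩⟩ := hA haA
    · exact absurd y.2 haX
    · rw [hza] at hzB
      exact le_of_sup_mem_imp hB hX haB hb hbX
        (le_sup_left.trans (show b ⊔ X ≤ a ⊔ X from hbw)) hzB
  intro A hA b hb hbA
  obtain ⟨A', hA', hbA', hmem⟩ := hB A (fun a ha => (hA ha).1) b hb hbA
  by_cases hX' : A'.sup id ≤ X
  · have hle : ∀ a ∈ A', a ≤ X := fun a ha => (Finset.le_sup (f := id) ha).trans hX'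
    set A₁ : Finset (Set.Iic X) := A'.attach.image fun a => ⟨a.1, hle a.1 a.2⟩
    have hsub : (↑A₁ : Set (Set.Iic X)) ⊆ N₁ := by
      intro w hw
      obtain ⟨a, -, rfl⟩ := Finset.mem_image.1 hw
      obtain ⟨-, ⟨y, hy, hya⟩ | ⟨haX, -⟩⟩ := hA (hA' a.2)
      · convert hy
        exact Subtype.ext hya.symm
      · exact absurd (hle a.1 a.2) haX
    have hsup : A'.sup id ≤ (A₁.sup id : Set.Iic X) := Finset.sup_le fun a ha => by
      have : (⟨a, hle a ha⟩ : Set.Iic X) ≤ A₁.sup id :=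
        Finset.le_sup (f := id) (Finset.mem_image.2 ⟨⟨a, ha⟩, Finset.mem_attach _ _, rfl⟩)
      exact this
    obtain ⟨w, hw, hbw⟩ := h₁ A₁ hsub ⟨b, hbA'.trans hX'⟩ hb
      (show b ≤ (A₁.sup id : Set.Iic X) from hbA'.trans hsup)
    obtain ⟨a, -, rfl⟩ := Finset.mem_image.1 hw
    exact ⟨a.1, hA' a.2, hbw⟩
  · obtain ⟨a, ha, hle⟩ := not_le A hA _ hmem (Finset.sup_mono hA') hX'
    exact ⟨a, ha, hbA'.trans hle⟩

theorem latConn_latContract_subset [Finite L] {B N : Set L} (X : L) (hN : latConn B ⊆ N) :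
    latConn (latContract B X) ⊆ latContract N X := by
  rintro z ⟨⟨b, hb, hbX, hzb⟩, hz⟩
  obtain ⟨c, hc, hbc⟩ := exists_mem_latConn hb
  have hcX : ¬ c ≤ X := fun h => hbX (hbc.trans h)
  refine ⟨c, hN hc, hcX, ?_⟩
  have := hz ⟨c ⊔ X, le_sup_right⟩ ⟨c, hc.1, hcX, rfl⟩
    (show (z : L) ≤ c ⊔ X from hzb ▸ sup_le_sup_right hbc X)
  exact congrArg Subtype.val this

theorem sup_mem_latConn_latContract {B : Set L} (hB : RefinesJoins B) {X c : L} (hX : X ∈ B)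
    (hc : c ∈ latConn B) (hcX : ¬ c ≤ X) :
    (⟨c ⊔ X, le_sup_right⟩ : Set.Ici X) ∈ latConn (latContract B X) := by
  refine ⟨⟨c, hc.1, hcX, rfl⟩, ?_⟩
  rintro w ⟨d, hd, hdX, hwd⟩ hle
  refine le_antisymm hle ?_
  change (w : L) ≤ c ⊔ X
  have hcd : c ≤ d ⊔ X :=
    (le_sup_left.trans (show c ⊔ X ≤ (w : L) from hle)).trans hwd.le
  rw [hwd]
  rcases hB.le_or_le_or_sup_mem hd hX hc.1 hcd with h | h | h
  · rw [hc.2 d hd h]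
  · exact absurd h hcX
  · exact le_sup_of_le_left (hc.2 _ h hcd).symm.le

theorem latConn_subset_latGlue {B : Set L} (hB : RefinesJoins B) {X : L} (hX : X ∈ B)
    (hXc : X ∉ latConn B) {N₁ : Set (Set.Iic X)} {N₂ : Set (Set.Ici X)}
    (h₂ : latConn (latContract B X) ⊆ N₂) : latConn B ⊆ latGlue B N₁ N₂ := by
  intro c hc
  have hcX : ¬ c ≤ X := fun h => hXc (hc.2 X hX h ▸ hc)
  exact ⟨hc.1, Or.inr ⟨hcX, _, h₂ (sup_mem_latConn_latContract hB hX hc hcX), rfl,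
    fun h => hc.2 _ h le_sup_left⟩⟩

theorem JoinPrimeOn.subset_of_contract_eq {B N N' : Set L} {X : L} (hP : JoinPrimeOn B N)
    (hP' : JoinPrimeOn B N') (hN : N ⊆ B) (hN' : N' ⊆ B) (hX : X ∈ N) (hX' : X ∈ N')
    (h₁ : latRestrict N X = latRestrict N' X) (h₂ : latContract N X = latContract N' X) :
    N ⊆ N' := by
  intro b hb
  by_cases hbX : b ≤ X
  · exact (Set.ext_iff.1 h₁ ⟨b, hbX⟩).1 hb
  · obtain ⟨b', hb', hbX', h⟩ :=
      (Set.ext_iff.1 h₂ ⟨b ⊔ X, le_sup_right⟩).1 ⟨b, hb, hbX, rfl⟩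
    change b ⊔ X = b' ⊔ X at h
    have hle : b ≤ b' :=
      (hP'.le_or_le hb' hX' (hN hb) (h ▸ le_sup_left)).resolve_right hbX
    have hge : b' ≤ b :=
      (hP.le_or_le hb hX (hN' hb') (h.symm ▸ le_sup_left)).resolve_right hbX'
    exact le_antisymm hle hge ▸ hb'

end RestrictionContraction

/-- **Links in lattice nested complexes.** For a building set `B` of a finite lattice `L` and
`X ∈ B ∖ latConn B`, the map `N ↦ (N_{≤X}, {b ⊔ X : b ∈ N, b ≰ X})` is a bijection from the
nested sets on `B` containing `X` onto the pairs consisting of a nested set on the restriction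
`B_{|X}` (a building set of `[⊥, X]`) and a nested set on the contraction `B_{/X}`
(a building set of `[X, ⊤]`). -/
theorem nested_link_bijection {L : Type*} [Lattice L] [BoundedOrder L] [Fintype L]
    (B : Set L) (hB : IsLatBuilding B) (X : L) (hX : X ∈ B) (hXc : X ∉ latConn B) :
    Set.BijOn
      (fun N : Set L =>
        (({Z : Set.Iic X | (Z : L) ∈ N} : Set (Set.Iic X)),
         ({Z : Set.Ici X | ∃ b ∈ N, ¬ b ≤ X ∧ (Z : L) = b ⊔ X} : Set (Set.Ici X))))
      {N : Set L | IsLatNested B N ∧ X ∈ N}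
      {p : Set (Set.Iic X) × Set (Set.Ici X) |
        IsLatNested {Z : Set.Iic X | (Z : L) ∈ B} p.1 ∧
        IsLatNested {Z : Set.Ici X | ∃ b ∈ B, ¬ b ≤ X ∧ (Z : L) = b ⊔ X} p.2} := by
  have hR : RefinesJoins B := hB.refinesJoins
  refine ⟨?_, ?_, ?_⟩
  · rintro N ⟨hN, hXN⟩
    have hP := hN.joinPrimeOn hB.1 hR
    refine ⟨(hP.restrict X).isLatNested (fun z hz => hN.1 hz) fun z hz => ?_,
      (hP.contract hXN).isLatNested ?_ (latConn_latContract_subset X hN.2.1)⟩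
    · change (z : L) ∈ N
      rwa [(mem_latConn_latRestrict_iff hX).1 hz]
    · rintro z ⟨b, hb, hz⟩
      exact ⟨b, hN.1 hb, hz⟩
  · rintro N ⟨hN, hXN⟩ N' ⟨hN', hXN'⟩ h
    have hP := hN.joinPrimeOn hB.1 hR
    have hP' := hN'.joinPrimeOn hB.1 hR
    obtain ⟨h₁, h₂⟩ := Prod.mk.inj h
    exact (hP.subset_of_contract_eq hP' hN.1 hN'.1 hXN hXN' h₁ h₂).antisymm
      (hP'.subset_of_contract_eq hP hN'.1 hN.1 hXN' hXN h₁.symm h₂.symm)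
  · rintro ⟨N₁, N₂⟩ ⟨h₁, h₂⟩
    have hP := joinPrimeOn_latGlue hR hX (h₁.joinPrimeOn hB.1 (hR.restrict X))
      (h₂.joinPrimeOn (bot_notMem_latContract B X) (hR.contract hX))
    refine ⟨latGlue B N₁ N₂,
      ⟨hP.isLatNested (fun b hb => hb.1) (latConn_subset_latGlue hR hX hXc h₂.2.1), hX, Or.inl
        ⟨⟨X, le_rfl⟩, h₁.2.1 ((mem_latConn_latRestrict_iff hX).2 rfl), rfl⟩⟩,
      Prod.ext (latRestrict_latGlue h₁.1) (latContract_latGlue h₂.1)⟩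
end

section
/- Let L and L' be finite lattices, 𝓑 an L-building set, and 𝓑' an L'-building set. Then 𝓑 ⊕ 𝓑' := {(B, ⊥') : B ∈ 𝓑} ∪ {(⊥, B') : B' ∈ 𝓑'} is an (L × L')-building set, its connected components are {(C, ⊥') : C ∈ 𝓒(𝓑)} ∪ {(⊥, C') : C' ∈ 𝓒(𝓑')}, and a subset N of 𝓑 ⊕ 𝓑' containing 𝓒(𝓑 ⊕ 𝓑') is an (L × L')-nested set on 𝓑 ⊕ 𝓑' if and only if {B : (B, ⊥') ∈ N} is an L-nested set on 𝓑 and {B' : (⊥, B') ∈ N} is an L'-nested set on 𝓑'. In particular, the (L × L')-nested complex of 𝓑 ⊕ 𝓑' is isomorphic to the join of the nested complexes of 𝓑 and 𝓑'. -/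
/-- The direct sum of two building sets, inside the Cartesian product lattice. -/
def dirSum {L L' : Type*} [Lattice L] [BoundedOrder L] [Lattice L'] [BoundedOrder L']
    (B : Set L) (B' : Set L') : Set (L × L') :=
  (fun b => (b, (⊥ : L'))) '' B ∪ (fun b' => ((⊥ : L), b')) '' B'

section OneLattice

variable {L : Type*} [Lattice L] [BoundedOrder L]

theorem latConn_eq_maxBelow_top (B : Set L) : latConn B = maxBelow B ⊤ := by
  ext X
  simp [latConn, maxBelow]

theorem hasFactorization_bot {B : Set L} (hB : ⊥ ∉ B) : HasFactorization B ⊥ := by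
  have hempty : IsEmpty (maxBelow B ⊥) :=
    ⟨fun X => hB (le_bot_iff.1 X.2.2.1 ▸ X.2.1)⟩
  have : Unique {t : maxBelow B ⊥ → L // ∀ X, t X ≤ (X : L)} :=
    { default := ⟨fun _ => ⊥, fun _ => bot_le⟩
      uniq := fun t => Subtype.ext (funext fun X => hempty.elim X) }
  have : Unique (Set.Iic (⊥ : L)) :=
    { default := ⟨⊥, le_rfl⟩
      uniq := fun y => Subtype.ext (le_bot_iff.1 y.2) }
  exact ⟨OrderIso.ofUnique _ _, fun _ X => hempty.elim X⟩

theorem IsLatBuilding.hasFactorization {B : Set L} (hB : IsLatBuilding B) (Y : L) :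
    HasFactorization B Y := by
  rcases eq_or_ne Y ⊥ with rfl | hY
  · exact hasFactorization_bot hB.1
  · exact hB.2 Y (bot_lt_iff_ne_bot.2 hY)

/-- A factorization isomorphism sends the zero tuple to `⊥`. -/
theorem factorization_apply_eq_bot {B : Set L} {Y : L}
    (φ : {t : maxBelow B Y → L // ∀ X, t X ≤ (X : L)} ≃o Set.Iic Y)
    (t : {t : maxBelow B Y → L // ∀ X, t X ≤ (X : L)}) (ht : ∀ X, t.val X = ⊥) :
    (φ t : L) = ⊥ := by
  have hle : t ≤ φ.symm ⟨⊥, bot_le⟩ := fun X => (ht X).le.trans bot_le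
  exact le_bot_iff.1 (φ.le_symm_apply.1 hle)

end OneLattice

section Embedding

variable {L P : Type*} [Lattice L] [BoundedOrder L] [Lattice P] [BoundedOrder P]
  {C : Set L} {D : Set P}

theorem map_finset_sup_id (i : L ↪o P) (hbot : i ⊥ = ⊥) (hsup : ∀ a b, i (a ⊔ b) = i a ⊔ i b)
    (A : Finset L) : (A.map i.toEmbedding).sup id = i (A.sup id) := by
  rw [Finset.sup_map, Finset.apply_sup_eq_sup_comp i hsup hbot]
  rfl

/-- Nestedness pulls back along an embedding that is compatible with the building sets. -/
theorem IsLatNested.preimage (i : L ↪o P) (hbot : i ⊥ = ⊥)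
    (hsup : ∀ a b, i (a ⊔ b) = i a ⊔ i b) (hD : ∀ b, i b ∈ D ↔ b ∈ C)
    (hconn : ∀ b, i b ∈ latConn D ↔ b ∈ latConn C) {N : Set P} (hN : IsLatNested D N) :
    IsLatNested C {b | i b ∈ N} := by
  refine ⟨fun b hb => (hD b).1 (hN.1 hb), fun b hb => hN.2.1 ((hconn b).2 hb), ?_⟩
  intro A hA hcard hanti hmem
  refine hN.2.2 (A.map i.toEmbedding) ?_ (by simpa using hcard) ?_ ?_
  · intro p hp
    obtain ⟨a, ha, rfl⟩ := Finset.mem_map.1 (Finset.mem_coe.1 hp)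
    exact ⟨(hA ha).1, fun h => (hA ha).2 ((hconn a).1 h)⟩
  · intro p hp q hq hpq
    obtain ⟨a, ha, rfl⟩ := Finset.mem_map.1 (Finset.mem_coe.1 hp)
    obtain ⟨b, hb, rfl⟩ := Finset.mem_map.1 (Finset.mem_coe.1 hq)
    simpa using hanti ha hb (fun h => hpq (by rw [h]))
  · rw [map_finset_sup_id i hbot hsup]
    exact (hD _).2 hmem

/-- If the trace of `N` along an embedding onto a lower set is nested, then no antichain of `N`
has a join that lies both in the image of the embedding and in the building set. -/
theorem IsLatNested.sup_notMem_of_preimage (i : L ↪o P) (hbot : i ⊥ = ⊥)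
    (hsup : ∀ a b, i (a ⊔ b) = i a ⊔ i b) (hlower : ∀ b, ∀ p ≤ i b, ∃ a, i a = p)
    (hD : ∀ b, i b ∈ D ↔ b ∈ C) (hconn : ∀ b, i b ∈ latConn D ↔ b ∈ latConn C) {N : Set P}
    (hN : IsLatNested C {b | i b ∈ N}) {A : Finset P} (hA : ↑A ⊆ N \ latConn D)
    (hcard : 2 ≤ A.card) (hanti : (↑A : Set P).Pairwise (fun x y => ¬ x ≤ y ∧ ¬ y ≤ x))
    {b : L} (hb : i b = A.sup id) : A.sup id ∉ D := by
  classical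
  obtain ⟨A₀, rfl⟩ : ∃ A₀ : Finset L, A = A₀.map i.toEmbedding := by
    refine ⟨A.preimage i i.injective.injOn, ?_⟩
    ext p
    simp only [Finset.mem_map, Finset.mem_preimage]
    refine ⟨fun hp => ?_, ?_⟩
    · obtain ⟨a, rfl⟩ := hlower b p (hb ▸ Finset.le_sup (f := id) hp)
      exact ⟨a, hp, rfl⟩
    · rintro ⟨a, ha, rfl⟩
      exact ha
  rw [map_finset_sup_id i hbot hsup, hD]
  refine hN.2.2 A₀ ?_ (by simpa using hcard) ?_
  · intro a ha
    have := hA (Finset.mem_coe.2 (Finset.mem_map_of_mem i.toEmbedding ha))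
    exact ⟨this.1, fun h => this.2 ((hconn a).2 h)⟩
  · intro a ha c hc hac
    simpa using hanti (Finset.mem_coe.2 (Finset.mem_map_of_mem i.toEmbedding ha))
      (Finset.mem_coe.2 (Finset.mem_map_of_mem i.toEmbedding hc)) (i.injective.ne hac)

end Embedding

section DirSum

variable {L L' : Type*} [Lattice L] [BoundedOrder L] [Lattice L'] [BoundedOrder L']
  {B' : Set L'} {B : Set L}

/-- The inclusion of the first factor as a lower set of the product. -/
def inlEmbedding (L L' : Type*) [Lattice L] [Lattice L'] [BoundedOrder L'] : L ↪o L × L' :=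
  OrderEmbedding.ofMapLEIff (fun b => (b, ⊥)) (by simp)

/-- The inclusion of the second factor as a lower set of the product. -/
def inrEmbedding (L L' : Type*) [Lattice L] [BoundedOrder L] [Lattice L'] : L' ↪o L × L' :=
  OrderEmbedding.ofMapLEIff (fun b' => (⊥, b')) (by simp)

theorem mk_bot_mem_image_union {S : Set L} {S' : Set L'} (hS' : ⊥ ∉ S') {b : L} :
    (b, ⊥) ∈ (fun b => (b, (⊥ : L'))) '' S ∪ (fun b' => ((⊥ : L), b')) '' S' ↔ b ∈ S := by
  constructor
  · rintro (⟨c, hc, h⟩ | ⟨c, hc, h⟩)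
    · obtain rfl := (Prod.ext_iff.1 h).1
      exact hc
    · obtain rfl := (Prod.ext_iff.1 h).2
      exact (hS' hc).elim
  · exact fun hb => Or.inl ⟨b, hb, rfl⟩

theorem bot_mk_mem_image_union {S : Set L} {S' : Set L'} (hS : ⊥ ∉ S) {b' : L'} :
    (⊥, b') ∈ (fun b => (b, (⊥ : L'))) '' S ∪ (fun b' => ((⊥ : L), b')) '' S' ↔ b' ∈ S' := by
  constructor
  · rintro (⟨c, hc, h⟩ | ⟨c, hc, h⟩)
    · obtain rfl := (Prod.ext_iff.1 h).1
      exact (hS hc).elim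
    · obtain rfl := (Prod.ext_iff.1 h).2
      exact hc
  · exact fun hb => Or.inr ⟨b', hb, rfl⟩

theorem maxBelow_dirSum (hB : ⊥ ∉ B) (hB' : ⊥ ∉ B') (Y : L × L') :
    maxBelow (dirSum B B') Y =
      (fun b => (b, (⊥ : L'))) '' maxBelow B Y.1 ∪
        (fun b' => ((⊥ : L), b')) '' maxBelow B' Y.2 := by
  ext X
  constructor
  · rintro ⟨⟨b, hb, rfl⟩ | ⟨b, hb, rfl⟩, hY, hmax⟩
    · refine Or.inl ⟨b, ⟨hb, hY.1, fun Z hZ hZY hbZ => ?_⟩, rfl⟩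
      exact congrArg Prod.fst
        (hmax (Z, ⊥) (Or.inl ⟨Z, hZ, rfl⟩) ⟨hZY, bot_le⟩ ⟨hbZ, le_rfl⟩)
    · refine Or.inr ⟨b, ⟨hb, hY.2, fun Z hZ hZY hbZ => ?_⟩, rfl⟩
      exact congrArg Prod.snd
        (hmax (⊥, Z) (Or.inr ⟨Z, hZ, rfl⟩) ⟨bot_le, hZY⟩ ⟨le_rfl, hbZ⟩)
  · rintro (⟨b, ⟨hb, hY, hmax⟩, rfl⟩ | ⟨b, ⟨hb, hY, hmax⟩, rfl⟩)
    · refine ⟨Or.inl ⟨b, hb, rfl⟩, ⟨hY, bot_le⟩, ?_⟩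
      rintro _ (⟨Z, hZ, rfl⟩ | ⟨Z, hZ, rfl⟩) hZY hbZ
      · exact Prod.ext (hmax Z hZ hZY.1 hbZ.1) rfl
      · exact (hB (le_bot_iff.1 hbZ.1 ▸ hb)).elim
    · refine ⟨Or.inr ⟨b, hb, rfl⟩, ⟨bot_le, hY⟩, ?_⟩
      rintro _ (⟨Z, hZ, rfl⟩ | ⟨Z, hZ, rfl⟩) hZY hbZ
      · exact (hB' (le_bot_iff.1 hbZ.2 ▸ hb)).elim
      · exact Prod.ext rfl (hmax Z hZ hZY.2 hbZ.2)

theorem latConn_dirSum (hB : ⊥ ∉ B) (hB' : ⊥ ∉ B') :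
    latConn (dirSum B B') =
      (fun b => (b, (⊥ : L'))) '' latConn B ∪ (fun b' => ((⊥ : L), b')) '' latConn B' := by
  simp only [latConn_eq_maxBelow_top]
  exact maxBelow_dirSum hB hB' ⊤

theorem hasFactorization_dirSum (hB : ⊥ ∉ B) (hB' : ⊥ ∉ B') {Y : L × L'}
    (h : HasFactorization B Y.1) (h' : HasFactorization B' Y.2) :
    HasFactorization (dirSum B B') Y := by
  classical
  obtain ⟨φ, hφ⟩ := h
  obtain ⟨ψ, hψ⟩ := h'
  have hM := maxBelow_dirSum hB hB' Y
  have hl : ∀ b ∈ maxBelow B Y.1, (b, (⊥ : L')) ∈ maxBelow (dirSum B B') Y := fun b hb =>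
    hM ▸ Or.inl ⟨b, hb, rfl⟩
  have hr : ∀ b ∈ maxBelow B' Y.2, ((⊥ : L), b) ∈ maxBelow (dirSum B B') Y := fun b hb =>
    hM ▸ Or.inr ⟨b, hb, rfl⟩
  have hcases : ∀ X : maxBelow (dirSum B B') Y,
      (∃ b, ∃ hb : b ∈ maxBelow B Y.1, X = ⟨(b, ⊥), hl b hb⟩) ∨
        ∃ b, ∃ hb : b ∈ maxBelow B' Y.2, X = ⟨(⊥, b), hr b hb⟩ := by
    rintro ⟨X, hX⟩
    rcases hM.subset hX with ⟨b, hb, rfl⟩ | ⟨b, hb, rfl⟩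
    · exact Or.inl ⟨b, hb, rfl⟩
    · exact Or.inr ⟨b, hb, rfl⟩
  let T := {t : maxBelow (dirSum B B') Y → L × L' // ∀ X, t X ≤ (X : L × L')}
  let fstTuple (t : T) : {t : maxBelow B Y.1 → L // ∀ X, t X ≤ (X : L)} :=
    ⟨fun X => (t.1 ⟨(X, ⊥), hl X X.2⟩).1, fun X => (t.2 ⟨(X, ⊥), hl X X.2⟩).1⟩
  let sndTuple (t : T) : {t : maxBelow B' Y.2 → L' // ∀ X, t X ≤ (X : L')} :=
    ⟨fun X => (t.1 ⟨(⊥, X), hr X X.2⟩).2, fun X => (t.2 ⟨(⊥, X), hr X X.2⟩).2⟩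
  let f (t : T) : Set.Iic Y := ⟨(φ (fstTuple t), ψ (sndTuple t)), (φ _).2, (ψ _).2⟩
  have hle : ∀ t s : T, f t ≤ f s ↔ t ≤ s := by
    intro t s
    have : f t ≤ f s ↔ fstTuple t ≤ fstTuple s ∧ sndTuple t ≤ sndTuple s :=
      (Iff.rfl : _ ↔ φ (fstTuple t) ≤ φ (fstTuple s) ∧ ψ (sndTuple t) ≤ ψ (sndTuple s)).trans
        (and_congr φ.le_iff_le ψ.le_iff_le)
    rw [this]
    refine ⟨fun ⟨h₁, h₂⟩ X => ?_, fun h => ⟨fun X => (h _).1, fun X => (h _).2⟩⟩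
    rcases hcases X with ⟨b, hb, rfl⟩ | ⟨b, hb, rfl⟩
    · exact ⟨h₁ ⟨b, hb⟩, (t.2 ⟨(b, ⊥), hl b hb⟩).2.trans bot_le⟩
    · exact ⟨(t.2 ⟨(⊥, b), hr b hb⟩).1.trans bot_le, h₂ ⟨b, hb⟩⟩
  have hsurj : Function.Surjective f := by
    rintro ⟨⟨y, y'⟩, hy⟩
    obtain ⟨t, ht⟩ := φ.surjective ⟨y, hy.1⟩
    obtain ⟨t', ht'⟩ := ψ.surjective ⟨y', hy.2⟩
    let s : T := ⟨fun X => (if h : X.1.1 ∈ maxBelow B Y.1 then t.1 ⟨_, h⟩ else ⊥,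
      if h : X.1.2 ∈ maxBelow B' Y.2 then t'.1 ⟨_, h⟩ else ⊥), fun X => by
        constructor
        · dsimp only
          split_ifs with h
          exacts [t.2 ⟨_, h⟩, bot_le]
        · dsimp only
          split_ifs with h
          exacts [t'.2 ⟨_, h⟩, bot_le]⟩
    have hs : fstTuple s = t := Subtype.ext (funext fun X => dif_pos X.2)
    have hs' : sndTuple s = t' := Subtype.ext (funext fun X => dif_pos X.2)
    refine ⟨s, Subtype.ext (Prod.ext ?_ ?_)⟩
    · change (φ (fstTuple s) : L) = y
      rw [hs, ht]
    · change (ψ (sndTuple s) : L') = y'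
      rw [hs', ht']
  refine ⟨RelIso.ofSurjective (OrderEmbedding.ofMapLEIff f hle) hsurj, fun t X hX => ?_⟩
  change ((φ (fstTuple t) : L), (ψ (sndTuple t) : L')) = t.1 X
  rcases hcases X with ⟨b, hb, rfl⟩ | ⟨b, hb, rfl⟩
  · refine Prod.ext (hφ _ ⟨b, hb⟩ fun X' hX' => ?_) ?_
    · exact congrArg Prod.fst (hX ⟨(X', ⊥), hl X' X'.2⟩ fun h =>
        hX' (Subtype.ext (congrArg (fun Z => Z.1.1) h)))
    · refine (factorization_apply_eq_bot ψ _ fun X' => ?_).trans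
        (le_bot_iff.1 (t.2 ⟨(b, ⊥), hl b hb⟩).2).symm
      exact congrArg Prod.snd (hX ⟨(⊥, X'), hr X' X'.2⟩ fun h =>
        hB' ((congrArg (fun Z => Z.1.2) h : X'.1 = ⊥) ▸ X'.2.1))
  · refine Prod.ext ?_ (hψ _ ⟨b, hb⟩ fun X' hX' => ?_)
    · refine (factorization_apply_eq_bot φ _ fun X' => ?_).trans
        (le_bot_iff.1 (t.2 ⟨(⊥, b), hr b hb⟩).1).symm
      exact congrArg Prod.fst (hX ⟨(X', ⊥), hl X' X'.2⟩ fun h =>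
        hB ((congrArg (fun Z => Z.1.1) h : X'.1 = ⊥) ▸ X'.2.1))
    · exact congrArg Prod.snd (hX ⟨(⊥, X'), hr X' X'.2⟩ fun h =>
        hX' (Subtype.ext (congrArg (fun Z => Z.1.2) h)))

theorem IsLatBuilding.dirSum (hB : IsLatBuilding B) (hB' : IsLatBuilding B') :
    IsLatBuilding (dirSum B B') :=
  ⟨fun h => hB.1 ((mk_bot_mem_image_union hB'.1).1 h), fun Y _ =>
    hasFactorization_dirSum hB.1 hB'.1 (hB.hasFactorization Y.1) (hB'.hasFactorization Y.2)⟩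

theorem isLatNested_dirSum_iff (hB : ⊥ ∉ B) (hB' : ⊥ ∉ B') {N : Set (L × L')}
    (hN : N ⊆ dirSum B B') (hconn : latConn (dirSum B B') ⊆ N) :
    IsLatNested (dirSum B B') N ↔
      IsLatNested B {b : L | (b, (⊥ : L')) ∈ N} ∧
        IsLatNested B' {b' : L' | ((⊥ : L), b') ∈ N} := by
  have hlD : ∀ b, inlEmbedding L L' b ∈ dirSum B B' ↔ b ∈ B := fun b =>
    mk_bot_mem_image_union hB'
  have hrD : ∀ b, inrEmbedding L L' b ∈ dirSum B B' ↔ b ∈ B' := fun b =>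
    bot_mk_mem_image_union hB
  have hlC : ∀ b, inlEmbedding L L' b ∈ latConn (dirSum B B') ↔ b ∈ latConn B := fun b => by
    rw [latConn_dirSum hB hB']
    exact mk_bot_mem_image_union fun h => hB' h.1
  have hrC : ∀ b, inrEmbedding L L' b ∈ latConn (dirSum B B') ↔ b ∈ latConn B' := fun b => by
    rw [latConn_dirSum hB hB']
    exact bot_mk_mem_image_union fun h => hB h.1
  have hlsup : ∀ a b, inlEmbedding L L' (a ⊔ b) = inlEmbedding L L' a ⊔ inlEmbedding L L' b :=
    fun a b => Prod.ext rfl (sup_idem _).symm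
  have hrsup : ∀ a b, inrEmbedding L L' (a ⊔ b) = inrEmbedding L L' a ⊔ inrEmbedding L L' b :=
    fun a b => Prod.ext (sup_idem _).symm rfl
  refine ⟨fun h => ⟨h.preimage (inlEmbedding L L') rfl hlsup hlD hlC,
    h.preimage (inrEmbedding L L') rfl hrsup hrD hrC⟩,
    fun ⟨h, h'⟩ => ⟨hN, hconn, fun A hA hcard hanti hmem => ?_⟩⟩
  obtain ⟨b, -, hb⟩ | ⟨b, -, hb⟩ := id hmem
  · exact h.sup_notMem_of_preimage (inlEmbedding L L') rfl hlsup
      (fun b p hp => ⟨p.1, Prod.ext rfl (le_bot_iff.1 hp.2).symm⟩) hlD hlC hA hcard hanti hb hmem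
  · exact h'.sup_notMem_of_preimage (inrEmbedding L L') rfl hrsup
      (fun b p hp => ⟨p.2, Prod.ext (le_bot_iff.1 hp.1).symm rfl⟩) hrD hrC hA hcard hanti hb hmem

end DirSum

/-- **Direct sums of building sets.** If `B` is a building set of a finite lattice `L` and `B'`
is a building set of a finite lattice `L'`, then `B ⊕ B'` is a building set of the product
lattice `L × L'`, its connected components are the copies of those of `B` and `B'`, and a
subset `N` of `B ⊕ B'` containing the connected components is nested if and only if its two
projections are nested sets on `B` and on `B'` respectively. -/
theorem dirSum_building_nested {L L' : Type*} [Lattice L] [BoundedOrder L] [Fintype L]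
    [Lattice L'] [BoundedOrder L'] [Fintype L']
    (B : Set L) (hB : IsLatBuilding B) (B' : Set L') (hB' : IsLatBuilding B') :
    IsLatBuilding (dirSum B B') ∧
    latConn (dirSum B B') =
      (fun b => (b, (⊥ : L'))) '' latConn B ∪ (fun b' => ((⊥ : L), b')) '' latConn B' ∧
    ∀ N : Set (L × L'), N ⊆ dirSum B B' → latConn (dirSum B B') ⊆ N →
      (IsLatNested (dirSum B B') N ↔
        IsLatNested B {b : L | (b, (⊥ : L')) ∈ N} ∧
        IsLatNested B' {b' : L' | ((⊥ : L), b') ∈ N}) :=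
  ⟨hB.dirSum hB', latConn_dirSum hB.1 hB'.1, fun _ => isLatNested_dirSum_iff hB.1 hB'.1⟩
end

section
/- Let φ : L → L' be an order embedding between finite lattices that sends cover relations of L to cover relations of L' (X ⋖ Y in L implies φ(X) ⋖ φ(Y) in L'). If B₁, …, B_k ∈ L are such that there is an order isomorphism from the product poset ∏_{i=1}^{k} L_{≤B_i} onto L_{≤ B₁ ∨ ⋯ ∨ B_k} whose i-th component is the interval inclusion, then φ(B₁ ∨_L ⋯ ∨_L B_k) = φ(B₁) ∨_{L'} ⋯ ∨_{L'} φ(B_k). -/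
/-- In a lower set of a product, lowering one coordinate along a cover gives a cover. -/
lemma Subtype.covBy_of_update_covBy {ι α : Type*} [DecidableEq ι] [PartialOrder α] {b : ι → α}
    (s t : {t : ι → α // ∀ i, t i ≤ b i}) {i : ι} {a : α} (hs : s.val = Function.update t.val i a)
    (ha : a ⋖ t.val i) : s ⋖ t := by
  refine CovBy.of_image (OrderEmbedding.subtype _) ?_
  change s.val ⋖ t.val
  refine Pi.covBy_iff.2 ⟨i, by simpa [hs] using ha, fun j hj => by simp [hs, hj]⟩

/-- A cover in a principal lower set is a cover in the ambient order. -/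
lemma Set.Iic.covBy_coe {α : Type*} [Preorder α] {c : α} {x y : Set.Iic c} (h : x ⋖ y) :
    (x : α) ⋖ y :=
  h.image (OrderEmbedding.subtype (· ∈ Set.Iic c)) (by
    rw [OrderEmbedding.coe_subtype, Subtype.range_coe_subtype]
    exact Set.ordConnected_Iic)

/-- For a factorization `ψ` of a lower interval, a cover-preserving order embedding sends the image
of a tuple below the join of the images of its entries. -/
lemma OrderEmbedding.apply_factorization_le_sup {ι L L' : Type*} [Fintype ι] [Nonempty ι]
    [Lattice L] [OrderBot L] [Finite L] [Lattice L'] [OrderBot L'] (φ : L ↪o L')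
    (hcov : ∀ X Y : L, X ⋖ Y → φ X ⋖ φ Y) {b : ι → L} {c : L}
    (ψ : {t : ι → L // ∀ i, t i ≤ b i} ≃o Set.Iic c)
    (hψ : ∀ (t : {t : ι → L // ∀ i, t i ≤ b i}) (i : ι),
      (∀ j, j ≠ i → t.val j = ⊥) → (ψ t : L) = t.val i)
    (t : {t : ι → L // ∀ i, t i ≤ b i}) :
    φ (ψ t) ≤ Finset.univ.sup fun i => φ (t.val i) := by
  classical
  induction t using WellFoundedLT.induction with
  | ind t ih =>
    by_cases h : ∃ i, ∀ j, j ≠ i → t.val j = ⊥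
    · obtain ⟨i, hi⟩ := h
      rw [hψ t i hi]
      exact Finset.le_sup (f := fun i => φ (t.val i)) (Finset.mem_univ i)
    · push Not at h
      obtain ⟨i, -, hi⟩ := h (Classical.arbitrary ι)
      obtain ⟨j, hji, hj⟩ := h i
      have lower : ∀ l, t.val l ≠ ⊥ → ∃ s : {t : ι → L // ∀ i, t i ≤ b i},
          s ⋖ t ∧ s.val l ≠ t.val l ∧ ∀ m, m ≠ l → s.val m = t.val m := by
        intro l hl
        obtain ⟨a, -, ha⟩ := exists_le_covBy_of_lt (bot_lt_iff_ne_bot.2 hl)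
        refine ⟨⟨Function.update t.val l a, fun m => ?_⟩,
          Subtype.covBy_of_update_covBy _ t rfl ha, by simpa using ha.ne,
          fun m hm => by simp [hm]⟩
        exact (update_le_self_iff.2 ha.le m).trans (t.2 m)
      obtain ⟨s, hst, -, hs⟩ := lower i hi
      obtain ⟨r, hrt, hr, -⟩ := lower j hj
      have image_covBy : ∀ {u}, u ⋖ t → φ (ψ u) ⋖ φ (ψ t) := fun hu =>
        hcov _ _ (Set.Iic.covBy_coe ((apply_covBy_apply_iff ψ).2 hu))
      have image_le : ∀ {u}, u ⋖ t → φ (ψ u) ≤ Finset.univ.sup fun i => φ (t.val i) := fun hu =>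
        (ih _ hu.lt).trans (Finset.sup_mono_fun fun m _ => φ.monotone (hu.le m))
      have hne : φ (ψ s) ≠ φ (ψ r) := fun h => by
        have hsr : s = r := ψ.injective (Subtype.ext (φ.injective h))
        exact hr (hsr ▸ hs j hji)
      rw [← (image_covBy hst).wcovBy.sup_eq (image_covBy hrt).wcovBy hne]
      exact sup_le (image_le hst) (image_le hrt)

/-- **Cover-preserving order embeddings preserve factored joins.** If `φ : L → L'` is an order
embedding between finite lattices that sends cover relations to cover relations, and
`B₁, …, B_k` (`k ≥ 1`) are elements of `L` such that there is an order isomorphism from the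
product poset `∏ᵢ L_{≤Bᵢ}` onto `L_{≤ B₁ ∨ ⋯ ∨ B_k}` whose `i`-th component is the interval
inclusion (i.e. it sends every tuple that is `⊥` away from the coordinate `i` to its `i`-th
entry), then `φ (B₁ ∨ ⋯ ∨ B_k) = φ B₁ ∨ ⋯ ∨ φ B_k`. -/
theorem orderEmbedding_covBy_apply_sup {L L' : Type*} [Lattice L] [BoundedOrder L] [Fintype L]
    [Lattice L'] [BoundedOrder L'] [Fintype L'] (φ : L ↪o L')
    (hcov : ∀ X Y : L, X ⋖ Y → φ X ⋖ φ Y)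
    (k : ℕ) (hk : 0 < k) (Bv : Fin k → L)
    (hfac : ∃ ψ : {t : Fin k → L // ∀ i, t i ≤ Bv i} ≃o Set.Iic (Finset.univ.sup Bv),
      ∀ (t : {t : Fin k → L // ∀ i, t i ≤ Bv i}) (i : Fin k),
        (∀ j, j ≠ i → t.val j = ⊥) → (ψ t : L) = t.val i) :
    φ (Finset.univ.sup Bv) = Finset.univ.sup fun i => φ (Bv i) := by
  obtain ⟨ψ, hψ⟩ := hfac
  have : Nonempty (Fin k) := ⟨⟨0, hk⟩⟩
  refine le_antisymm ?_
    (Finset.sup_le fun i hi => φ.monotone (Finset.le_sup (f := Bv) hi))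
  obtain ⟨t, ht⟩ := ψ.surjective ⟨Finset.univ.sup Bv, le_rfl⟩
  calc φ (Finset.univ.sup Bv) = φ (ψ t) := by rw [ht]
    _ ≤ Finset.univ.sup fun i => φ (t.val i) := φ.apply_factorization_le_sup hcov ψ hψ t
    _ ≤ Finset.univ.sup fun i => φ (Bv i) :=
      Finset.sup_mono_fun fun i _ => φ.monotone (t.2 i)
end

section
/- Let φ : L → L' be an order embedding between finite lattices satisfying at least one of the following three conditions: (i) atom exhaustive: every atom A' of L' with A' ≤ φ(⊤_L) belongs to the image φ(L); (ii) join preserving: φ(X ∨ Y) = φ(X) ∨ φ(Y) for all X, Y ∈ L; (iii) cover preserving: X ⋖ Y in L implies φ(X) ⋖ φ(Y) in L'. Let 𝓑 be an L-building set and 𝓑' an L'-building set such that 𝓑 = φ⁻¹(𝓑'). Then for every L-nested set N on 𝓑, the set φ(N∖𝓒(𝓑)) ∪ 𝓒(𝓑') is an L'-nested set on 𝓑'. In particular, φ embeds the L-nested complex of 𝓑 as a subcomplex of the L'-nested complex of 𝓑'. -/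
lemma exists_le_maxBelow {L : Type*} [Lattice L] [Finite L] {B : Set L} {b Y : L} (hb : b ∈ B)
    (hbY : b ≤ Y) :
    ∃ M ∈ maxBelow B Y, b ≤ M := by
  obtain ⟨M, hbM, hM⟩ :=
    (Set.toFinite {Z | Z ∈ B ∧ Z ≤ Y}).exists_le_maximal (a := b) ⟨hb, hbY⟩
  exact ⟨M, ⟨hM.prop.1, hM.prop.2, fun Z hZ hZY h => le_antisymm h (hM.2 ⟨hZ, hZY⟩ h)⟩, hbM⟩

section Factorization

variable {L : Type*} [Lattice L] [BoundedOrder L]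

/-- Under a factorization, an element below a factor lies below the image of a tuple if and only
if it lies below the corresponding component. -/
lemma HasFactorization.exists_orderIso {B : Set L} {Y : L} (h : HasFactorization B Y) :
    ∃ φ : {t : maxBelow B Y → L // ∀ X, t X ≤ (X : L)} ≃o Set.Iic Y,
      ∀ t u (X : maxBelow B Y), u ≤ (X : L) → ((u ≤ (φ t : L)) ↔ u ≤ t.val X) := by
  classical
  obtain ⟨φ, hφ⟩ := h
  refine ⟨φ, fun t u X hu => ?_⟩
  let s : {t : maxBelow B Y → L // ∀ X, t X ≤ (X : L)} :=
    ⟨fun X' => if X' = X then u else ⊥, fun X' => by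
      by_cases hX : X' = X
      · subst hX; simpa using hu
      · simp [hX]⟩
  have hs : (φ s : L) = u := by
    rw [hφ s X fun X' hX => if_neg hX]
    exact if_pos rfl
  rw [← hs, Subtype.coe_le_coe, φ.le_iff_le, hs]
  constructor
  · intro h
    simpa [s] using h X
  · intro h X'
    by_cases hX : X' = X
    · subst hX; simpa [s] using h
    · simp [s, hX]

lemma IsLatBuilding.le_of_forall_le {B : Set L} (hB : IsLatBuilding B) {Y u : L}
    (h : ∀ b ∈ B, b ≤ Y → b ≤ u) : Y ≤ u := by
  rcases eq_bot_or_bot_lt Y with rfl | hY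
  · exact bot_le
  obtain ⟨φ, hφ⟩ := (hB.2 Y hY).exists_orderIso
  let v : Set.Iic Y := ⟨Y ⊓ u, inf_le_left⟩
  have key : φ.symm ⟨Y, le_rfl⟩ ≤ φ.symm v := fun X =>
    ((φ.symm ⟨Y, le_rfl⟩).2 X).trans <| (hφ _ _ X le_rfl).1 <| by
      rw [φ.apply_symm_apply]
      exact le_inf X.2.2.1 (h _ X.2.1 X.2.2.1)
  have hle : Y ≤ Y ⊓ u := φ.symm.le_iff_le.1 key
  exact hle.trans inf_le_right

/-- Distinct maximal elements of a building set below `Y` have trivial meet. -/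
lemma HasFactorization.eq_bot_of_le {B : Set L} {Y M₁ M₂ x : L} (h : HasFactorization B Y)
    (h₁ : M₁ ∈ maxBelow B Y) (h₂ : M₂ ∈ maxBelow B Y) (hne : M₁ ≠ M₂)
    (hx₁ : x ≤ M₁) (hx₂ : x ≤ M₂) : x = ⊥ := by
  classical
  obtain ⟨φ, hφ⟩ := h.exists_orderIso
  let t : {t : maxBelow B Y → L // ∀ X, t X ≤ (X : L)} :=
    ⟨fun X => if (X : L) = M₁ then X else ⊥, fun X => by
      by_cases hX : (X : L) = M₁ <;> simp [hX]⟩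
  have hx : x ≤ (φ t : L) := (hφ t x ⟨M₁, h₁⟩ hx₁).2 (by simpa [t] using hx₁)
  have := (hφ t x ⟨M₂, h₂⟩ hx₂).1 hx
  simpa [t, hne.symm] using this

/-- Let `M` be maximal in `B` below the join of `A`. If every element of `A` lies below a maximal
element, then `M` is the only `u ≤ M` bounding all elements of `A` below `M`. -/
lemma HasFactorization.eq_of_join {B : Set L} {A : Finset L} {M u : L}
    (h : HasFactorization B (A.sup id)) (hM : M ∈ maxBelow B (A.sup id)) (hu : u ≤ M)
    (hA : ∀ a ∈ A, ∃ M' ∈ maxBelow B (A.sup id), a ≤ M')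
    (hAM : ∀ a ∈ A, a ≤ M → a ≤ u) : u = M := by
  classical
  obtain ⟨φ, hφ⟩ := h.exists_orderIso
  let t : {t : maxBelow B (A.sup id) → L // ∀ X, t X ≤ (X : L)} :=
    ⟨fun X => if (X : L) = M then u else X, fun X => by
      by_cases hX : (X : L) = M
      · simpa [hX] using hu
      · simp [hX]⟩
  have hY : A.sup id ≤ (φ t : L) := Finset.sup_le fun a ha => by
    obtain ⟨M', hM', haM'⟩ := hA a ha
    refine (hφ t a ⟨M', hM'⟩ haM').2 ?_
    by_cases hX : M' = M
    · subst hX; simpa [t] using hAM a ha haM'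
    · simpa [t, hX] using haM'
  have := (hφ t M ⟨M, hM⟩ le_rfl).1 (hM.2.1.trans hY)
  exact le_antisymm hu (by simpa [t] using this)

/-- Every element of the building set below the join of a nested antichain lies below one of
its members. -/
lemma IsLatNested.exists_le_of_le_sup [Finite L] {B N : Set L} (hB : IsLatBuilding B)
    (hN : IsLatNested B N) {A : Finset L} (hAN : ↑A ⊆ N \ latConn B)
    (hanti : (↑A : Set L).Pairwise fun x y => ¬ x ≤ y ∧ ¬ y ≤ x) {b : L} (hb : b ∈ B)
    (hbA : b ≤ A.sup id) : ∃ a ∈ A, b ≤ a := by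
  classical
  have hbot : ∀ {x}, x ∈ B → x ≠ ⊥ := fun hx h => hB.1 (h ▸ hx)
  obtain ⟨M, hM, hbM⟩ := exists_le_maxBelow hb hbA
  have hpos : ⊥ < A.sup id := (bot_lt_iff_ne_bot.2 (hbot hb)).trans_le hbA
  let A₁ := A.filter (· ≤ M)
  have hsub : (A₁ : Set L) ⊆ A := fun a ha => (Finset.mem_filter.1 ha).1
  have hjoin : A₁.sup id = M := by
    refine (hB.2 _ hpos).eq_of_join hM (Finset.sup_le fun a ha => (Finset.mem_filter.1 ha).2)
      (fun a ha => exists_le_maxBelow (hN.1 (hAN ha).1) (Finset.le_sup (f := id) ha))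
      fun a ha haM => Finset.le_sup (f := id) (Finset.mem_filter.2 ⟨ha, haM⟩)
  have hcard : A₁.card < 2 := by
    by_contra hc
    exact hN.2.2 A₁ (hsub.trans hAN) (not_lt.1 hc) (hanti.mono hsub) (hjoin ▸ hM.1)
  have hne : A₁.card ≠ 0 := by
    intro h0
    rw [Finset.card_eq_zero.1 h0] at hjoin
    exact hbot hM.1 (by simpa using hjoin.symm)
  obtain ⟨a, ha⟩ := Finset.card_eq_one.1 (show A₁.card = 1 by omega)
  have haM : a = M := by simpa [ha] using hjoin
  exact ⟨a, hsub (by simp [ha]), haM ▸ hbM⟩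

end Factorization

/-- If `φ` is cover preserving, any upper bound of the images of `⊥` and of the elements of a
building set below `Y` is an upper bound of the image of `Y`. -/
lemma map_le_of_cover_preserving {L L' : Type*} [Lattice L] [BoundedOrder L] [Finite L]
    [Lattice L'] {φ : L ↪o L'} (hφ : ∀ X Y : L, X ⋖ Y → φ X ⋖ φ Y) {B : Set L}
    (hB : IsLatBuilding B) {W : L'} {Y : L} (hbot : φ ⊥ ≤ W)
    (hW : ∀ b ∈ B, b ≤ Y → φ b ≤ W) : φ Y ≤ W := by
  induction Y using WellFoundedLT.induction with
  | ind z ih =>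
  by_contra hz
  have hlt : ∀ w < z, φ w ≤ W := fun w hw => ih w hw fun b hb hbw => hW b hb (hbw.trans hw.le)
  have hcov : ∀ w, w ⋖ z → φ w = φ z ⊓ W := fun w hw =>
    ((hφ w z hw).eq_or_eq (le_inf (φ.monotone hw.le) (hlt w hw.lt)) inf_le_left).elim
      Eq.symm fun h => absurd (inf_eq_left.1 h) hz
  have hz0 : ⊥ < z := bot_lt_iff_ne_bot.2 fun h => hz (h ▸ hbot)
  obtain ⟨w, -, hw⟩ := exists_le_covBy_of_lt hz0
  refine hw.lt.not_ge (hB.le_of_forall_le fun b hb hbz => ?_)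
  have hbz' : b < z := hbz.lt_of_ne fun h => hz (h ▸ hW b hb hbz)
  obtain ⟨w', hbw', hw'⟩ := exists_le_covBy_of_lt hbz'
  exact hbw'.trans (φ.injective ((hcov w' hw').trans (hcov w hw).symm)).le

/-- Let `φ` be atom exhaustive. If some `W ∈ B'` below `φ Y` bounds the images of `⊥` and of the
elements of the building set `B` below `Y`, then `B'` contains the image of `Y`. -/
lemma mem_of_atom_exhaustive {L L' : Type*} [Lattice L] [BoundedOrder L]
    [Lattice L'] [BoundedOrder L'] [Finite L'] {φ : L ↪o L'}
    (hφ : ∀ A' : L', IsAtom A' → A' ≤ φ ⊤ → A' ∈ Set.range φ) {B : Set L}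
    (hB : IsLatBuilding B) {B' : Set L'} (hB' : IsLatBuilding B') {W : L'} {Y : L}
    (hWB : W ∈ B') (hWY : W ≤ φ Y) (hbot : φ ⊥ ≤ W) (hW : ∀ b ∈ B, b ≤ Y → φ b ≤ W) :
    φ Y ∈ B' := by
  by_contra hYB
  have hW0 : ∀ {x}, x ∈ B' → x ≠ ⊥ := fun hx h => hB'.1 (h ▸ hx)
  obtain ⟨M₁, hM₁, hWM₁⟩ := exists_le_maxBelow hWB hWY
  have hnot : ¬ φ Y ≤ M₁ := fun h => hYB (le_antisymm h hM₁.2.1 ▸ hM₁.1)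
  obtain ⟨b', hb', hbY', hbM'⟩ : ∃ b' ∈ B', b' ≤ φ Y ∧ ¬ b' ≤ M₁ := by
    by_contra! h
    exact hnot (hB'.le_of_forall_le h)
  obtain ⟨M₂, hM₂, hbM₂⟩ := exists_le_maxBelow hb' hbY'
  have hne : M₁ ≠ M₂ := fun h => hbM' (h ▸ hbM₂)
  obtain ⟨a, ha, haM₂⟩ := (eq_bot_or_exists_atom_le M₂).resolve_left (hW0 hM₂.1)
  have hpos : ⊥ < φ Y := (bot_lt_iff_ne_bot.2 (hW0 hWB)).trans_le hWY
  have haM₁ : ¬ a ≤ M₁ := fun h =>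
    ha.1 ((hB'.2 _ hpos).eq_bot_of_le hM₁ hM₂ hne h haM₂)
  have haY : a ≤ φ Y := haM₂.trans hM₂.2.1
  obtain ⟨x, rfl⟩ := hφ a ha (haY.trans (φ.monotone le_top))
  have hxY : x ≤ Y := φ.le_iff_le.1 haY
  refine haM₁ ((φ.monotone ?_).trans (hbot.trans hWM₁))
  refine hB.le_of_forall_le fun b hb hbx => absurd ?_ haM₁
  have hb0 : ⊥ < φ b := bot_le.trans_lt
    (φ.strictMono (bot_lt_iff_ne_bot.2 fun h => hB.1 (h ▸ hb)))
  rw [← (ha.le_iff.1 (φ.monotone hbx)).resolve_left hb0.ne']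
  exact (hW b hb (hbx.trans hxY)).trans hWM₁

/-- **Tame order embeddings yield nested complex embeddings.** Let `φ : L → L'` be an order
embedding between finite lattices which is atom exhaustive, or join preserving, or cover
preserving.  If `B` is a building set of `L`, `B'` a building set of `L'` and `B = φ⁻¹ B'`,
then for every `L`-nested set `N` on `B`, the set `φ(N ∖ latConn B) ∪ latConn B'` is an
`L'`-nested set on `B'`; in particular `φ` embeds the nested complex of `B` as a subcomplex of
the nested complex of `B'`. -/
theorem tame_embedding_nested {L L' : Type*} [Lattice L] [BoundedOrder L] [Fintype L]
    [Lattice L'] [BoundedOrder L'] [Fintype L'] (φ : L ↪o L')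
    (htame :
      (∀ A' : L', IsAtom A' → A' ≤ φ ⊤ → A' ∈ Set.range φ) ∨
      (∀ X Y : L, φ (X ⊔ Y) = φ X ⊔ φ Y) ∨
      (∀ X Y : L, X ⋖ Y → φ X ⋖ φ Y))
    (B : Set L) (hB : IsLatBuilding B)
    (B' : Set L') (hB' : IsLatBuilding B')
    (hpre : B = ⇑φ ⁻¹' B') :
    ∀ N : Set L, IsLatNested B N →
      IsLatNested B' (⇑φ '' (N \ latConn B) ∪ latConn B') := by
  classical
  intro N hN
  refine ⟨?_, Set.subset_union_right, ?_⟩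
  · rintro _ (⟨x, hx, rfl⟩ | hx)
    · exact (hpre ▸ hN.1 hx.1 : x ∈ ⇑φ ⁻¹' B')
    · exact hx.1
  intro A' hA' hcard hanti hmem
  have hsub : (A' : Set L') ⊆ ⇑φ '' (N \ latConn B) := fun x hx =>
    (hA' hx).1.resolve_right (hA' hx).2
  obtain ⟨A, hAN, rfl⟩ := Finset.subset_set_image_iff.1 hsub
  rw [Finset.card_image_of_injective _ φ.injective] at hcard
  have hantiA : (↑A : Set L).Pairwise fun x y => ¬ x ≤ y ∧ ¬ y ≤ x := fun x hx y hy hxy => by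
    simpa using hanti (Finset.mem_coe.2 (Finset.mem_image_of_mem φ hx))
      (Finset.mem_coe.2 (Finset.mem_image_of_mem φ hy)) (φ.injective.ne hxy)
  have hY : A.sup id ∉ B := hN.2.2 A hAN hcard hantiA
  have hYB : φ (A.sup id) ∉ B' := fun h => hY (hpre ▸ h)
  have hAW : ∀ a ∈ A, φ a ≤ (A.image φ).sup id := fun a ha =>
    Finset.le_sup (f := id) (Finset.mem_image_of_mem φ ha)
  have hWY : (A.image φ).sup id ≤ φ (A.sup id) := Finset.sup_le fun y hy => by
    obtain ⟨a, ha, rfl⟩ := Finset.mem_image.1 hy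
    exact φ.monotone (Finset.le_sup (f := id) ha)
  have hne : A.Nonempty := Finset.card_pos.1 (by omega)
  have hbot : φ ⊥ ≤ (A.image φ).sup id := by
    obtain ⟨a, ha⟩ := hne
    exact (φ.monotone bot_le).trans (hAW a ha)
  have hW : ∀ b ∈ B, b ≤ A.sup id → φ b ≤ (A.image φ).sup id := fun b hb hbY => by
    obtain ⟨a, ha, hba⟩ := hN.exists_le_of_le_sup hB hAN hantiA hb hbY
    exact (φ.monotone hba).trans (hAW a ha)
  have hnot : ¬ φ (A.sup id) ≤ (A.image φ).sup id := fun h =>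
    hYB (le_antisymm h hWY ▸ hmem)
  rcases htame with hat | hjoin | hcov
  · exact hYB (mem_of_atom_exhaustive hat hB hB' hmem hWY hbot hW)
  · refine hnot ?_
    rw [← Finset.sup'_eq_sup hne, Finset.apply_sup'_eq_sup'_comp hne φ hjoin]
    exact Finset.sup'_le _ _ hAW
  · exact hnot (map_le_of_cover_preserving hcov hB hbot hW)
end

section
/- Let L be a finite atomic lattice (every element of L is a join of atoms) with set of atoms S, and define φ : L → 2^S by φ(X) = {s ∈ S : s ≤ X}. Then φ is an order embedding of L into the boolean lattice of subsets of S ordered by inclusion. Moreover, for any L-building set 𝓑, letting 𝓑' be the building closure of {φ(B) : B ∈ 𝓑}, i.e., the smallest building set on S containing all the sets φ(B), one has for every X ∈ L: φ(X) ∈ 𝓑' if and only if X ∈ 𝓑. -/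
section LatticePrelims

variable {L : Type*} [Lattice L] [BoundedOrder L]

/-- The set of atoms of `L` lying below `X`; as `X` ranges over an atomic lattice `L`, this is
the canonical map from `L` to the boolean lattice of sets of atoms of `L`. -/
def atomsBelow (X : L) : Set {a : L // IsAtom a} :=
  {s | (s : L) ≤ X}

end LatticePrelims

/-- A (boolean) building set on the ground set `S`: a collection of nonempty subsets of `S`
containing all singletons and such that any two members with nonempty intersection have their
union in the collection. -/
def IsBoolBuilding {S : Type*} (C : Set (Set S)) : Prop :=
  (∀ c ∈ C, c.Nonempty) ∧ (∀ s : S, {s} ∈ C) ∧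
    ∀ c ∈ C, ∀ d ∈ C, (c ∩ d).Nonempty → c ∪ d ∈ C

section LatBuilding

variable {L : Type*} [Lattice L] {B : Set L}

/-- In a finite lattice, every element of `B` below `Y` lies below a maximal such element. -/
theorem exists_le_mem_maxBelow_s8 [Finite L] {b Y : L} (hb : b ∈ B) (hbY : b ≤ Y) :
    ∃ M ∈ maxBelow B Y, b ≤ M := by
  obtain ⟨M, hbM, hM⟩ := (Set.toFinite {Z | Z ∈ B ∧ Z ≤ Y}).exists_le_maximal ⟨hb, hbY⟩
  exact ⟨M, ⟨hM.prop.1, hM.prop.2, fun Z hZ hZY hMZ => hM.eq_of_le ⟨hZ, hZY⟩ hMZ⟩, hbM⟩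

variable [BoundedOrder L]

/-- The maximal elements of `B` below a factorizing element are pairwise disjoint. -/
theorem HasFactorization.eq_bot_of_le_s8 {Y a : L} (h : HasFactorization B Y)
    {M N : maxBelow B Y} (hMN : M ≠ N) (haM : a ≤ M) (haN : a ≤ N) : a = ⊥ := by
  classical
  obtain ⟨φ, hφ⟩ := h
  have single_le : ∀ P : maxBelow B Y, a ≤ P →
      ∀ X, (Function.update (fun _ => ⊥) P a : maxBelow B Y → L) X ≤ X := by
    intro P hP X
    by_cases hX : X = P
    · subst hX; simpa using hP
    · simp [hX]
  have image_single : ∀ (P : maxBelow B Y) (hP : a ≤ P), (φ ⟨_, single_le P hP⟩ : L) = a := by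
    intro P hP
    rw [hφ _ P fun X hX => by simp [hX]]
    simp
  have heq := φ.injective (Subtype.ext ((image_single M haM).trans (image_single N haN).symm))
  simpa [hMN] using congrFun (congrArg Subtype.val heq) M

/-- A factorizing element other than `⊥` has some element of `B` below it. -/
theorem HasFactorization.nonempty_maxBelow {Y : L} (h : HasFactorization B Y) (hY : ⊥ < Y) :
    (maxBelow B Y).Nonempty := by
  obtain ⟨φ, -⟩ := h
  by_contra hne
  have : IsEmpty (maxBelow B Y) :=
    Set.isEmpty_coe_sort.2 (Set.not_nonempty_iff_eq_empty.1 hne)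
  have hsub : φ.symm ⟨⊥, bot_le⟩ = φ.symm ⟨Y, le_rfl⟩ := Subtype.ext (Subsingleton.elim _ _)
  exact hY.ne (congrArg Subtype.val (φ.symm.injective hsub))

theorem IsLatBuilding.mem_of_isAtom (hB : IsLatBuilding B) {a : L} (ha : IsAtom a) : a ∈ B := by
  obtain ⟨M, hMB, hMa, -⟩ := (hB.2 a ha.bot_lt).nonempty_maxBelow ha.bot_lt
  rcases ha.le_iff.1 hMa with rfl | rfl
  · exact absurd hMB hB.1
  · exact hMB

theorem IsLatBuilding.sup_mem [Finite L] (hB : IsLatBuilding B) {a b c : L} (hb : b ∈ B)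
    (hc : c ∈ B) (ha : a ≠ ⊥) (hab : a ≤ b) (hac : a ≤ c) : b ⊔ c ∈ B := by
  obtain ⟨M, hM, hbM⟩ := exists_le_mem_maxBelow_s8 hb (le_sup_left : b ≤ b ⊔ c)
  obtain ⟨N, hN, hcN⟩ := exists_le_mem_maxBelow_s8 hc (le_sup_right : c ≤ b ⊔ c)
  have hY : ⊥ < b ⊔ c := (bot_lt_iff_ne_bot.2 ha).trans_le (hab.trans le_sup_left)
  have hMN : M = N := by
    by_contra hne
    exact ha ((hB.2 _ hY).eq_bot_of_le_s8 (M := ⟨M, hM⟩) (N := ⟨N, hN⟩)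
      (fun h => hne (congrArg Subtype.val h)) (hab.trans hbM) (hac.trans hcN))
  subst hMN
  rw [← le_antisymm hM.2.1 (sup_le hbM hcN)]
  exact hM.1

/-- An element that is a join of atoms is the join of all the atoms below it. -/
theorem isLUB_atomsBelow {X : L}
    (hX : ∃ A : Finset L, (∀ a ∈ A, IsAtom a) ∧ X = A.sup id) :
    IsLUB (Subtype.val '' atomsBelow X) X := by
  obtain ⟨A, hA, rfl⟩ := hX
  refine ⟨?_, fun Z hZ => Finset.sup_le fun a ha => ?_⟩
  · rintro _ ⟨s, hs, rfl⟩
    exact hs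
  · exact hZ ⟨⟨a, hA a ha⟩, Finset.le_sup (f := id) ha, rfl⟩

/-- The sets of atoms whose join lies in a building set of `L` form a boolean building set. -/
theorem IsLatBuilding.isBoolBuilding_setOf_isLUB [Finite L] (hB : IsLatBuilding B) :
    IsBoolBuilding {c : Set {a : L // IsAtom a} |
      c.Nonempty ∧ ∃ b ∈ B, IsLUB (Subtype.val '' c) b} := by
  refine ⟨fun c hc => hc.1, fun s => ⟨Set.singleton_nonempty s, s, hB.mem_of_isAtom s.2, ?_⟩, ?_⟩
  · rw [Set.image_singleton]
    exact isLUB_singleton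
  · rintro c ⟨hc, b, hb, hbc⟩ d ⟨-, b', hb', hbd⟩ ⟨s, hsc, hsd⟩
    refine ⟨hc.inl, b ⊔ b', hB.sup_mem hb hb' s.2.1 (hbc.1 ⟨s, hsc, rfl⟩) (hbd.1 ⟨s, hsd, rfl⟩), ?_⟩
    rw [Set.image_union]
    exact hbc.union hbd

end LatBuilding

/-- **Atomic lattices embed into boolean lattices, compatibly with building sets.** For a
finite atomic lattice `L` with set of atoms `S`, the map `φ : X ↦ {s ∈ S : s ≤ X}` is an order
embedding of `L` into the boolean lattice of subsets of `S`; moreover, for any `L`-building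
set `B`, if `C` is the building closure on `S` of `{φ b : b ∈ B}` (the smallest building set
on `S` containing all these sets), then for every `X ∈ L` one has `φ X ∈ C ↔ X ∈ B`. -/
theorem atomic_building_pushable {L : Type*} [Lattice L] [BoundedOrder L] [Fintype L]
    (hatomic : ∀ X : L, ∃ A : Finset L, (∀ a ∈ A, IsAtom a) ∧ X = A.sup id)
    (B : Set L) (hB : IsLatBuilding B) :
    (∀ X Y : L, atomsBelow X ⊆ atomsBelow Y ↔ X ≤ Y) ∧
    ∀ C : Set (Set {a : L // IsAtom a}),
      IsBoolBuilding C → (∀ b ∈ B, atomsBelow b ∈ C) →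
      (∀ D : Set (Set {a : L // IsAtom a}),
        IsBoolBuilding D → (∀ b ∈ B, atomsBelow b ∈ D) → C ⊆ D) →
      ∀ X : L, (atomsBelow X ∈ C ↔ X ∈ B) := by
  have hlub : ∀ X : L, IsLUB (Subtype.val '' atomsBelow X) X := fun X =>
    isLUB_atomsBelow (hatomic X)
  refine ⟨fun X Y => ⟨fun h => (hlub X).mono (hlub Y) (Set.image_mono h),
    fun h s hs => le_trans hs h⟩, fun C _ hBC hmin X => ⟨fun hX => ?_, hBC X⟩⟩
  have hne : ∀ b ∈ B, (atomsBelow b).Nonempty := by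
    intro b hb
    by_contra hne
    have hbot := hlub b
    rw [Set.not_nonempty_iff_eq_empty.1 hne, Set.image_empty, isLUB_empty_iff, isBot_iff_eq_bot]
      at hbot
    exact hB.1 (hbot ▸ hb)
  obtain ⟨-, b, hb, hbX⟩ := hmin _ hB.isBoolBuilding_setOf_isLUB
    (fun b hb => ⟨hne b hb, b, hb, hlub b⟩) hX
  rwa [(hlub X).unique hbX]
end

section
/- Let E be a finite-dimensional real inner product space, A = (a_s)_{s∈S} a finite acyclic family of vectors of E, and 𝓑 an oriented building set for A. Then for every B ∈ 𝓑, the smallest face cl_A(B) of A containing B (i.e., the intersection of all faces of A containing B) is itself a face of A and belongs to 𝓑. -/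
/-- `F` is a face of the family of vectors `A`: some linear functional vanishes on
`{A s : s ∈ F}` and is positive on the remaining vectors of the family. -/
def IsFaceOf {S E : Type*} [AddCommGroup E] [Module ℝ E] (A : S → E) (F : Set S) : Prop :=
  ∃ f : E →ₗ[ℝ] ℝ, (∀ s ∈ F, f (A s) = 0) ∧ ∀ s ∉ F, 0 < f (A s)

/-- `c` is the support of a support-minimal nonzero linear dependence of the family `A`. -/
def IsCircuitSupport {S E : Type*} [Fintype S] [AddCommGroup E] [Module ℝ E]
    (A : S → E) (c : Set S) : Prop :=
  ∃ δ : S → ℝ, δ ≠ 0 ∧ ∑ s, δ s • A s = 0 ∧ c = {s | δ s ≠ 0} ∧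
    ∀ δ' : S → ℝ, δ' ≠ 0 → ∑ s, δ' s • A s = 0 →
      {s | δ' s ≠ 0} ⊆ {s | δ s ≠ 0} → {s | δ' s ≠ 0} = {s | δ s ≠ 0}

/-- An oriented building set for the family `A`: a building set on `S` containing all the
circuit supports of `A`. -/
def IsOrientedBuilding {S E : Type*} [Fintype S] [AddCommGroup E] [Module ℝ E]
    (A : S → E) (B : Set (Set S)) : Prop :=
  IsBoolBuilding B ∧ ∀ c : Set S, IsCircuitSupport A c → c ∈ B

/-- The smallest face of `A` containing `X`: the intersection of all faces of `A`
containing `X`. -/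
def faceClosure {S E : Type*} [AddCommGroup E] [Module ℝ E] (A : S → E) (X : Set S) : Set S :=
  ⋂₀ {F | IsFaceOf A F ∧ X ⊆ F}

/-- `δ` is a linear dependence of `A` that is nonnegative outside `b`. -/
def IsDependenceNonnegOff {S E : Type*} [Fintype S] [AddCommGroup E] [Module ℝ E]
    (A : S → E) (b : Set S) (δ : S → ℝ) : Prop :=
  ∑ s, δ s • A s = 0 ∧ ∀ s ∉ b, 0 ≤ δ s

/-- The elements of `b` together with all elements having positive coefficient in some dependence
of `A` that is nonnegative outside `b`. -/
def dependenceClosure {S E : Type*} [Fintype S] [AddCommGroup E] [Module ℝ E]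
    (A : S → E) (b : Set S) : Set S :=
  {u | u ∈ b ∨ ∃ δ, IsDependenceNonnegOff A b δ ∧ 0 < δ u}

section Dependence

variable {S E : Type*} [Fintype S] [AddCommGroup E] [Module ℝ E] {A : S → E} {b : Set S}

/-- A dependence nonnegative outside `b` vanishes outside every face containing `b`. -/
theorem IsDependenceNonnegOff.eq_zero_of_notMem_face {δ : S → ℝ}
    (hδ : IsDependenceNonnegOff A b δ) {F : Set S} (hF : IsFaceOf A F) (hbF : b ⊆ F)
    {u : S} (hu : u ∉ F) : δ u = 0 := by
  obtain ⟨f, hf0, hfpos⟩ := hF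
  have hsum : ∑ s, δ s * f (A s) = 0 := by simpa using congrArg f hδ.1
  have hnonneg : ∀ s ∈ Finset.univ, 0 ≤ δ s * f (A s) := by
    intro s _
    by_cases hs : s ∈ F
    · simp [hf0 s hs]
    · exact mul_nonneg (hδ.2 s fun h => hs (hbF h)) (hfpos s hs).le
  have hzero := (Finset.sum_eq_zero_iff_of_nonneg hnonneg).1 hsum u (Finset.mem_univ u)
  exact (mul_eq_zero.1 hzero).resolve_right (hfpos u hu).ne'

theorem dependenceClosure_subset_face {F : Set S} (hF : IsFaceOf A F) (hbF : b ⊆ F) :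
    dependenceClosure A b ⊆ F := by
  rintro u (hu | ⟨δ, hδ, hpos⟩)
  · exact hbF hu
  · by_contra hu
    exact hpos.ne' (hδ.eq_zero_of_notMem_face hF hbF hu)

/-- Given coefficients `δ` and a direction `δ'` agreeing in sign with `δ` somewhere, one can move
from `δ` against `δ'` until a first coordinate vanishes, without changing signs. -/
theorem exists_sub_smul_vanishing {δ δ' : S → ℝ} (h : ∃ u, 0 < δ u * δ' u) :
    ∃ t : ℝ, 0 < t ∧ (∀ v, 0 ≤ δ v * (δ v - t * δ' v)) ∧
      ∃ w, 0 < δ w * δ' w ∧ δ w - t * δ' w = 0 := by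
  classical
  obtain ⟨u, hu⟩ := h
  obtain ⟨w, hw, hmin⟩ := (Finset.univ.filter fun v => 0 < δ v * δ' v).exists_min_image
    (fun v => δ v / δ' v) ⟨u, by simpa using hu⟩
  simp only [Finset.mem_filter, Finset.mem_univ, true_and] at hw hmin
  have ratio_pos : ∀ v, 0 < δ v * δ' v → 0 < δ v / δ' v := fun v hv =>
    div_pos_iff.2 (mul_pos_iff.1 hv)
  refine ⟨δ w / δ' w, ?_, fun v => ?_, w, hw, ?_⟩
  · exact ratio_pos w hw
  · rcases lt_or_ge 0 (δ v * δ' v) with hv | hv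
    · have hne : δ' v ≠ 0 := right_ne_zero_of_mul hv.ne'
      have hle := mul_le_mul_of_nonneg_right (hmin v hv) hv.le
      have hcancel : δ v / δ' v * (δ v * δ' v) = δ v * δ v := by field_simp
      nlinarith
    · nlinarith [mul_nonneg (ratio_pos w hw).le (neg_nonneg.2 hv), mul_self_nonneg (δ v)]
  · have hne : δ' w ≠ 0 := right_ne_zero_of_mul hw.ne'
    field_simp
    ring

/-- A dependence nonnegative outside `b` and positive at `u` can be replaced by one
whose support is a circuit support. -/
theorem exists_circuit_of_isDependenceNonnegOff {u : S}
    (h : ∃ δ, IsDependenceNonnegOff A b δ ∧ 0 < δ u) :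
    ∃ δ, IsDependenceNonnegOff A b δ ∧ 0 < δ u ∧ IsCircuitSupport A {s | δ s ≠ 0} := by
  classical
  obtain ⟨δ, ⟨hδ, hδu⟩, hmin⟩ := exists_minimalFor_of_wellFoundedLT
    (fun δ : S → ℝ => IsDependenceNonnegOff A b δ ∧ 0 < δ u) (fun δ => {s | δ s ≠ 0}) h
  refine ⟨δ, hδ, hδu, δ, fun h0 => by simp [h0] at hδu, hδ.1, rfl, fun δ' hne hdep hsub => ?_⟩
  by_contra hssub
  -- Moving against a suitable direction contradicts minimality.
  have no_common_sign : ∀ ε : S → ℝ, ∑ s, ε s • A s = 0 → {s | ε s ≠ 0} ⊆ {s | δ s ≠ 0} →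
      ε u ≤ 0 → ∀ v, δ v * ε v ≤ 0 := by
    intro ε hεdep hεsub hεu v
    by_contra! hv
    obtain ⟨t, ht, hconf, w, hw, hw0⟩ := exists_sub_smul_vanishing ⟨v, hv⟩
    have hsupp : {s | δ s - t * ε s ≠ 0} ⊆ {s | δ s ≠ 0} := by
      intro s hs hs0
      have : ε s = 0 := by
        by_contra hεs
        exact hεsub hεs hs0
      exact hs (by simp [hs0, this])
    have hle := hmin (j := fun s => δ s - t * ε s) ⟨⟨?_, fun s hs => ?_⟩, ?_⟩ hsupp
    · exact hle (show δ w ≠ 0 from left_ne_zero_of_mul hw.ne') hw0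
    · simp only [sub_smul, mul_smul, Finset.sum_sub_distrib, ← Finset.smul_sum, hδ.1, hεdep,
        smul_zero, sub_zero]
    · rcases (hδ.2 s hs).eq_or_lt with h0 | hpos
      · by_contra hlt
        exact hsupp (show δ s - t * ε s ≠ 0 from fun h => hlt h.ge) h0.symm
      · exact nonneg_of_mul_nonneg_right (hconf s) hpos
    · show 0 < δ u - t * ε u
      nlinarith
  have neg_direction : ∀ ε : S → ℝ, ∑ s, ε s • A s = 0 → ∑ s, (-ε) s • A s = 0 := by
    intro ε hε
    simp [hε]
  have not_smaller_support : ∀ ε : S → ℝ, ε ≠ 0 → ∑ s, ε s • A s = 0 → {s | ε s ≠ 0} ⊆ {s | δ s ≠ 0} →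
      ¬ {s | δ s ≠ 0} ⊆ {s | ε s ≠ 0} → ε u ≤ 0 → False := by
    intro ε hε0 hεdep hεsub hεss hεu
    have hprod := no_common_sign ε hεdep hεsub hεu
    rcases hεu.eq_or_lt with h0 | hneg
    · refine hε0 (funext fun v => ?_)
      have hprod' := no_common_sign (-ε) (neg_direction ε hεdep) (by simpa using hεsub)
        (by simp [h0]) v
      have hmul : δ v * ε v = 0 := le_antisymm (hprod v) (by simpa using hprod')
      by_contra hv
      exact (mul_ne_zero (hεsub hv) hv) hmul
    · refine hεss ?_
      have hle := hmin (j := -ε) ⟨⟨neg_direction ε hεdep, fun s hs => ?_⟩, by simpa using hneg⟩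
        (by simpa using hεsub)
      · simpa using hle
      · by_contra! hlt
        have hεs : 0 < ε s := by simpa using hlt
        have hδs : 0 < δ s := (hδ.2 s hs).lt_of_ne' (hεsub hεs.ne')
        exact (mul_pos hδs hεs).not_ge (hprod s)
  have hnot : ¬ {s | δ s ≠ 0} ⊆ {s | δ' s ≠ 0} := fun h => hssub (hsub.antisymm h)
  rcases le_total (δ' u) 0 with hu | hu
  · exact not_smaller_support δ' hne hdep hsub hnot hu
  · exact not_smaller_support (-δ') (neg_ne_zero.2 hne) (neg_direction δ' hdep) (by simpa using hsub)
      (by simpa using hnot) (by simpa using hu)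

/-- Any coefficients can be dominated, on the dependence closure of `b` and outside `b`, by a
dependence that is nonnegative outside `b`. -/
theorem exists_isDependenceNonnegOff_ge (A : S → E) (b : Set S) (c : S → ℝ) :
    ∃ η, IsDependenceNonnegOff A b η ∧ ∀ u ∈ dependenceClosure A b, u ∉ b → c u ≤ η u := by
  classical
  have hex : ∀ u, ∃ δ, IsDependenceNonnegOff A b δ ∧
      (u ∈ dependenceClosure A b → u ∉ b → 0 < δ u) := by
    intro u
    by_cases hu : u ∈ dependenceClosure A b ∧ u ∉ b
    · obtain ⟨δ, hδ, hpos⟩ := hu.1.resolve_left hu.2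
      exact ⟨δ, hδ, fun _ _ => hpos⟩
    · exact ⟨0, ⟨by simp, by simp⟩, fun h1 h2 => absurd ⟨h1, h2⟩ hu⟩
  choose δ hδ hpos using hex
  have hterm : ∀ s ∉ b, ∀ u, 0 ≤ |c u / δ u u| * δ u s := fun s hs u =>
    mul_nonneg (abs_nonneg _) ((hδ u).2 s hs)
  refine ⟨fun s => ∑ u, |c u / δ u u| * δ u s, ⟨?_, fun s hs => ?_⟩, fun u hu hub => ?_⟩
  · simp only [Finset.sum_smul, mul_smul]
    rw [Finset.sum_comm]
    simp only [← Finset.smul_sum, (hδ _).1, smul_zero, Finset.sum_const_zero]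
  · exact Finset.sum_nonneg fun u _ => hterm s hs u
  · have hp := hpos u hu hub
    calc c u = c u / δ u u * δ u u := (div_mul_cancel₀ _ hp.ne').symm
      _ ≤ |c u / δ u u| * δ u u := mul_le_mul_of_nonneg_right (le_abs_self _) hp.le
      _ ≤ _ := Finset.single_le_sum (f := fun v => |c v / δ v v| * δ v u)
        (fun v _ => hterm u hub v) (Finset.mem_univ u)

end Dependence

section Separation

variable {S E : Type*} [NormedAddCommGroup E] [InnerProductSpace ℝ E] [Fintype S]

theorem isFaceOf_dependenceClosure (A : S → E) (b : Set S) :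
    IsFaceOf A (dependenceClosure A b) := by
  classical
  set T := dependenceClosure A b
  let L : (S → ℝ) →ₗ[ℝ] E := Fintype.linearCombination ℝ A
  have hL : ∀ w, L w = ∑ s, w s • A s := fun w => Fintype.linearCombination_apply ℝ A w
  let W : Submodule ℝ E := (Submodule.pi Tᶜ fun _ => (⊥ : Submodule ℝ ℝ)).map L
  let V : Submodule ℝ (S → ℝ) := Submodule.pi T fun _ => (⊥ : Submodule ℝ ℝ)
  have hV : ∀ w, w ∈ V ↔ ∀ t ∈ T, w t = 0 := fun w => by simp [V, Submodule.mem_pi]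
  let C : Set E := L '' (stdSimplex ℝ S ∩ V)
  have hCconv : Convex ℝ C := ((convex_stdSimplex ℝ S).inter V.convex).linear_image L
  have hCcomp : IsCompact C :=
    ((isCompact_stdSimplex ℝ S).inter_right V.closed_of_finiteDimensional).image
      L.continuous_of_finiteDimensional
  have hdisj : Disjoint C (W : Set E) := by
    rw [Set.disjoint_left]
    rintro _ ⟨w, ⟨⟨hw0, hw1⟩, hwT⟩, rfl⟩ ⟨c, hc, hcw⟩
    rw [SetLike.mem_coe, hV] at hwT
    have hc' : ∀ t ∉ T, c t = 0 := by simpa [Submodule.mem_pi] using hc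
    obtain ⟨η, hη, hge⟩ := exists_isDependenceNonnegOff_ge A b c
    have hδ : IsDependenceNonnegOff A b (w - c + η) := by
      refine ⟨?_, fun s hs => ?_⟩
      · rw [← hL, map_add, map_sub, hcw, sub_self, zero_add, hL, hη.1]
      · have h1 := hw0 s
        have h2 := hη.2 s hs
        simp only [Pi.add_apply, Pi.sub_apply]
        by_cases hsT : s ∈ T
        · linarith [hge s hsT hs]
        · linarith [hc' s hsT]
    have hwzero : ∀ s, w s = 0 := by
      intro s
      by_contra hs
      have hsT : s ∉ T := fun h => hs (hwT s h)
      have hsb : s ∉ b := fun h => hsT (Or.inl h)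
      refine hsT (Or.inr ⟨_, hδ, ?_⟩)
      simp only [Pi.add_apply, Pi.sub_apply, hc' s hsT]
      linarith [(hw0 s).lt_of_ne' hs, hη.2 s hsb]
    simp [hwzero] at hw1
  obtain ⟨f, x, y, hfC, hxy, hfW⟩ := geometric_hahn_banach_compact_closed hCconv hCcomp
    W.convex W.closed_of_finiteDimensional hdisj
  have hfW0 : ∀ z ∈ W, f z = 0 := by
    intro z hz
    by_contra hne
    have := hfW (((y - 1) / f z) • z) (W.smul_mem _ hz)
    rw [map_smul, smul_eq_mul, div_mul_cancel₀ _ hne] at this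
    linarith
  have hy : y < 0 := by simpa using hfW 0 W.zero_mem
  have hLsingle : ∀ s, L (Pi.single s 1) = A s := fun s => by simp [L]
  refine ⟨-(f : E →ₗ[ℝ] ℝ), fun s hs => ?_, fun s hs => ?_⟩
  · have hmem : A s ∈ W := by
      refine ⟨Pi.single s 1, ?_, hLsingle s⟩
      simp only [SetLike.mem_coe, Submodule.mem_pi, Submodule.mem_bot]
      intro t ht
      exact Pi.single_eq_of_ne (ne_of_mem_of_not_mem hs ht).symm _
    simp [hfW0 _ hmem]
  · have hmem : A s ∈ C := by
      refine ⟨Pi.single s 1, ⟨single_mem_stdSimplex ℝ s, ?_⟩, hLsingle s⟩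
      rw [SetLike.mem_coe, hV]
      intro t ht
      exact Pi.single_eq_of_ne (ne_of_mem_of_not_mem ht hs) _
    have := hfC _ hmem
    simp only [LinearMap.neg_apply, ContinuousLinearMap.coe_coe]
    linarith

theorem faceClosure_eq_dependenceClosure (A : S → E) (b : Set S) :
    faceClosure A b = dependenceClosure A b :=
  Set.Subset.antisymm
    (Set.sInter_subset_of_mem ⟨isFaceOf_dependenceClosure A b, fun _ => Or.inl⟩)
    (Set.subset_sInter fun _ hF => dependenceClosure_subset_face hF.1 hF.2)

end Separation

/-- A block of an oriented building set can be enlarged, inside its dependence closure, to a block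
containing any given element of that closure. -/
theorem IsOrientedBuilding.exists_mem_of_mem_dependenceClosure {S E : Type*} [Fintype S]
    [AddCommGroup E] [Module ℝ E] {A : S → E} {B : Set (Set S)} (hB : IsOrientedBuilding A B)
    (hacyc : IsFaceOf A (∅ : Set S)) {b : Set S} (hb : b ∈ B) {u : S}
    (hu : u ∈ dependenceClosure A b) (hface : IsFaceOf A (dependenceClosure A b)) :
    ∃ d ∈ B, b ⊆ d ∧ d ⊆ dependenceClosure A b ∧ u ∈ d := by
  by_cases hub : u ∈ b
  · exact ⟨b, hb, subset_rfl, fun _ => Or.inl, hub⟩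
  obtain ⟨δ, hδ, hpos, hcirc⟩ := exists_circuit_of_isDependenceNonnegOff (hu.resolve_left hub)
  refine ⟨b ∪ {s | δ s ≠ 0}, hB.1.2.2 b hb _ (hB.2 _ hcirc) ?_, Set.subset_union_left,
    Set.union_subset (fun _ => Or.inl) fun s hs => ?_, Or.inr hpos.ne'⟩
  · by_contra hempty
    rw [Set.not_nonempty_iff_eq_empty] at hempty
    have hδ' : IsDependenceNonnegOff A ∅ δ := by
      refine ⟨hδ.1, fun s _ => ?_⟩
      by_cases hs : s ∈ b
      · by_contra h0
        exact (hempty ▸ (⟨hs, fun h => h0 h.ge⟩ : s ∈ b ∩ {s | δ s ≠ 0}) : s ∈ (∅ : Set S))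
      · exact hδ.2 s hs
    exact hpos.ne' (hδ'.eq_zero_of_notMem_face hacyc subset_rfl (Set.notMem_empty u))
  · by_contra hsT
    exact hs (hδ.eq_zero_of_notMem_face hface (fun _ => Or.inl) hsT)

/-- **The face closure of a block is a block** (Lemma `smallestFaceContainingBlock`). For a
finite acyclic family `A` of vectors of a finite-dimensional real inner product space and an
oriented building set `B` for `A`, the smallest face of `A` containing a block `b ∈ B` is a
face of `A` and belongs to `B`. -/
theorem faceClosure_mem_orientedBuilding {S E : Type*} [NormedAddCommGroup E]
    [InnerProductSpace ℝ E] [FiniteDimensional ℝ E] [Fintype S]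
    (A : S → E) (hacyc : IsFaceOf A (∅ : Set S))
    (B : Set (Set S)) (hB : IsOrientedBuilding A B) :
    ∀ b ∈ B, IsFaceOf A (faceClosure A b) ∧ faceClosure A b ∈ B := by
  intro b hb
  rw [faceClosure_eq_dependenceClosure]
  have hface := isFaceOf_dependenceClosure A b
  refine ⟨hface, ?_⟩
  obtain ⟨M, ⟨hMB, hbM, hMT⟩, hmax⟩ :=
    (Set.toFinite {d | d ∈ B ∧ b ⊆ d ∧ d ⊆ dependenceClosure A b}).exists_maximal
      ⟨b, hb, subset_rfl, fun _ => Or.inl⟩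
  suffices h : dependenceClosure A b ⊆ M from h.antisymm hMT ▸ hMB
  intro u hu
  obtain ⟨d, hdB, hbd, hdT, hud⟩ := hB.exists_mem_of_mem_dependenceClosure hacyc hb hu hface
  have hmem : M ∪ d ∈ B := hB.1.2.2 M hMB d hdB ((hB.1.1 b hb).mono (Set.subset_inter hbM hbd))
  exact hmax ⟨hmem, hbM.trans Set.subset_union_left, Set.union_subset hMT hdT⟩
    Set.subset_union_left (Or.inr hud)
end

section
/- Let E be a finite-dimensional real inner product space, A = (a_s)_{s∈S} a finite acyclic family of vectors of E, and 𝓑 an oriented building set for A. Then for any B₁, B₂ ∈ 𝓑 with B₁ ∩ B₂ ≠ ∅, the smallest face cl_A(B₁ ∪ B₂) of A containing B₁ ∪ B₂ belongs to 𝓑; in particular it belongs to 𝓕 := {B ∈ 𝓑 : B is a face of A}. -/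
/-- **Farkas' lemma** for a finite family of vectors: a vector is either a nonnegative combination
of the family, or separated from the family by a linear functional. -/
theorem exists_nonneg_sum_eq_or_exists_separating {ι E : Type*} [AddCommGroup E] [Module ℝ E]
    (I : Finset ι) (v : ι → E) (b : E) :
    (∃ c : ι → ℝ, (∀ i, 0 ≤ c i) ∧ ∑ i ∈ I, c i • v i = b) ∨
      ∃ f : E →ₗ[ℝ] ℝ, (∀ i ∈ I, 0 ≤ f (v i)) ∧ f b < 0 := by
  classical
  induction I using Finset.induction_on generalizing v b with
  | empty =>
    by_cases hb : b = 0
    · exact .inl ⟨0, by simp, by simp [hb]⟩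
    · obtain ⟨f, hf⟩ : ∃ f : Module.Dual ℝ E, f b ≠ 0 := by
        by_contra! h
        exact hb ((Module.forall_dual_apply_eq_zero_iff ℝ b).1 h)
      rcases lt_or_gt_of_ne hf with h | h
      · exact .inr ⟨f, by simp, h⟩
      · exact .inr ⟨-f, by simp, by simpa using h⟩
  | insert j I hj ih =>
    rcases ih v b with ⟨c, hc, hcb⟩ | ⟨f, hf, hfb⟩
    · refine .inl ⟨fun i => if i = j then 0 else c i, fun i => ?_, ?_⟩
      · dsimp only
        split_ifs
        exacts [le_rfl, hc i]
      · rw [Finset.sum_insert hj, ← hcb]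
        beta_reduce
        rw [if_pos rfl, zero_smul, zero_add]
        refine Finset.sum_congr rfl fun i hi => ?_
        rw [if_neg (ne_of_mem_of_not_mem hi hj)]
    rcases le_or_gt 0 (f (v j)) with hj0 | hj0
    · exact .inr ⟨f, by simpa using ⟨hj0, hf⟩, hfb⟩
    set π : E →ₗ[ℝ] E := LinearMap.id - ((f (v j))⁻¹ • f).smulRight (v j) with hπ
    have hπ_apply (x : E) : π x = x - ((f (v j))⁻¹ * f x) • v j := by simp [hπ]
    rcases ih (fun i => π (v i)) (π b) with ⟨c, hc, hcb⟩ | ⟨g, hg, hgb⟩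
    · refine .inl ⟨fun i => if i = j then (f (v j))⁻¹ * (f b - ∑ i ∈ I, c i * f (v i)) else c i,
        fun i => ?_, ?_⟩
      · dsimp only
        split_ifs
        · refine mul_nonneg_of_nonpos_of_nonpos (inv_nonpos.2 hj0.le) ?_
          have := Finset.sum_nonneg fun i hi => mul_nonneg (hc i) (hf i hi)
          linarith
        · exact hc i
      · have hI : ∑ i ∈ I, (if i = j then (f (v j))⁻¹ * (f b - ∑ i ∈ I, c i * f (v i)) else c i)
            • v i = ∑ i ∈ I, c i • v i :=
          Finset.sum_congr rfl fun i hi => by rw [if_neg (ne_of_mem_of_not_mem hi hj)]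
        rw [Finset.sum_insert hj, hI]
        beta_reduce
        rw [if_pos rfl]
        have hcb' : π (∑ i ∈ I, c i • v i) = π b := by simpa using hcb
        rw [hπ_apply, hπ_apply] at hcb'
        have hsum : f (∑ i ∈ I, c i • v i) = ∑ i ∈ I, c i * f (v i) := by simp
        rw [hsum] at hcb'
        rw [mul_sub, sub_smul]
        rw [← sub_eq_zero] at hcb' ⊢
        rw [← hcb']
        abel
    · refine .inr ⟨g ∘ₗ π, ?_, hgb⟩
      intro i hi
      rcases Finset.mem_insert.1 hi with rfl | hi
      · simp [hπ_apply, inv_mul_cancel₀ hj0.ne]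
      · exact hg i hi

/-- If two real families `δ`, `δ'` agree in sign somewhere, then some `δ - t • δ'` with `t > 0`
vanishes somewhere on the support of `δ` and opposes the sign of `δ` nowhere. -/
theorem exists_pos_sub_mul_conformal {S : Type*} [Finite S] (δ δ' : S → ℝ)
    (h : ∃ u, 0 < δ u * δ' u) :
    ∃ t > 0, (∀ u, 0 ≤ δ u * (δ u - t * δ' u)) ∧ ∃ u, δ u ≠ 0 ∧ δ u - t * δ' u = 0 := by
  obtain ⟨u, hu, hmin⟩ :=
    Set.exists_min_image {u | 0 < δ u * δ' u} (fun u => δ u / δ' u) (Set.toFinite _) h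
  have hu : 0 < δ u * δ' u := hu
  have hne : δ u ≠ 0 := left_ne_zero_of_mul hu.ne'
  have hne' : δ' u ≠ 0 := right_ne_zero_of_mul hu.ne'
  have ht : 0 < δ u / δ' u := by
    rw [← mul_div_mul_right _ _ hne']
    exact div_pos hu (mul_self_pos.2 hne')
  refine ⟨δ u / δ' u, ht, fun w => ?_, u, hne, by field_simp; simp⟩
  rcases le_or_gt (δ w * δ' w) 0 with hw | hw
  · nlinarith [mul_self_nonneg (δ w), mul_nonneg ht.le (neg_nonneg.2 hw)]
  · have hw' : δ' w ≠ 0 := right_ne_zero_of_mul hw.ne'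
    have hle := mul_le_mul_of_nonneg_left (hmin w hw) hw.le
    have : δ w * δ' w * (δ w / δ' w) = δ w * δ w := by field_simp
    nlinarith

/-- The zero set on the family of a functional that is nonnegative on the family is a face. -/
theorem isFaceOf_zeros {S E : Type*} [AddCommGroup E] [Module ℝ E] {A : S → E}
    {f : E →ₗ[ℝ] ℝ} (hf : ∀ s, 0 ≤ f (A s)) : IsFaceOf A {s | f (A s) = 0} :=
  ⟨f, fun _ hs => hs, fun s hs => (hf s).lt_of_ne' hs⟩

theorem IsFaceOf.exists_nonneg {S E : Type*} [AddCommGroup E] [Module ℝ E] {A : S → E}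
    {F : Set S} (hF : IsFaceOf A F) :
    ∃ f : E →ₗ[ℝ] ℝ, (∀ s, 0 ≤ f (A s)) ∧ F = {s | f (A s) = 0} := by
  obtain ⟨f, hf₀, hf⟩ := hF
  refine ⟨f, fun s => ?_, Set.ext fun s => ⟨hf₀ s, fun hs => ?_⟩⟩
  · by_cases hs : s ∈ F
    exacts [(hf₀ s hs).ge, (hf s hs).le]
  · by_contra h
    exact (hf s h).ne' hs

theorem IsFaceOf.inter {S E : Type*} [AddCommGroup E] [Module ℝ E] {A : S → E}
    {F G : Set S} (hF : IsFaceOf A F) (hG : IsFaceOf A G) : IsFaceOf A (F ∩ G) := by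
  obtain ⟨f, hf, rfl⟩ := hF.exists_nonneg
  obtain ⟨g, hg, rfl⟩ := hG.exists_nonneg
  convert isFaceOf_zeros (f := f + g) fun s => add_nonneg (hf s) (hg s) using 1
  ext s
  exact (add_eq_zero_iff_of_nonneg (hf s) (hg s)).symm

theorem isFaceOf_faceClosure {S E : Type*} [Finite S] [AddCommGroup E] [Module ℝ E]
    (A : S → E) (X : Set S) : IsFaceOf A (faceClosure A X) := by
  have hfin : FiniteInter {F | IsFaceOf A F} :=
    ⟨⟨0, by simp, by simp⟩, fun _ hF _ hG => hF.inter hG⟩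
  have := hfin.finiteInter_mem (Set.toFinite {F | IsFaceOf A F ∧ X ⊆ F}).toFinset
    fun F hF => ((Set.Finite.mem_toFinset _).1 hF).1
  rwa [Set.Finite.coe_toFinset] at this

theorem subset_faceClosure {S E : Type*} [AddCommGroup E] [Module ℝ E]
    (A : S → E) (X : Set S) : X ⊆ faceClosure A X :=
  Set.subset_sInter fun _ hF => hF.2

/-- An element of the face closure of `X` outside of `X` has a positive coefficient in some linear
dependence that is nonnegative outside of `X`. -/
theorem exists_dependence_of_mem_faceClosure {S E : Type*} [Fintype S] [AddCommGroup E]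
    [Module ℝ E] {A : S → E} {X : Set S} {s : S} (hs : s ∈ faceClosure A X) (hsX : s ∉ X) :
    ∃ δ : S → ℝ, ∑ u, δ u • A u = 0 ∧ 0 < δ s ∧ ∀ u ∉ X, 0 ≤ δ u := by
  classical
  rcases exists_nonneg_sum_eq_or_exists_separating (Finset.univ : Finset (S ⊕ S))
    (Sum.elim A fun u => if u ∈ X then -A u else 0) (-A s) with ⟨c, hc, hcs⟩ | ⟨f, hf, hfs⟩
  · refine ⟨fun u => c (.inl u) - (if u ∈ X then c (.inr u) else 0) + if u = s then 1 else 0,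
      ?_, ?_, fun u hu => ?_⟩
    · have hneg : ∑ u, c (.inr u) • (if u ∈ X then -A u else 0) =
          -∑ u, (if u ∈ X then c (.inr u) else 0) • A u := by
        rw [← Finset.sum_neg_distrib]
        refine Finset.sum_congr rfl fun u _ => ?_
        split_ifs <;> simp
      rw [Fintype.sum_sum_type] at hcs
      simp only [Sum.elim_inl, Sum.elim_inr] at hcs
      rw [hneg] at hcs
      simp only [add_smul, sub_smul, Finset.sum_add_distrib, Finset.sum_sub_distrib]
      rw [sub_eq_add_neg, hcs]
      simp
    · have := hc (.inl s)
      simp only [hsX, if_false, if_true]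
      linarith
    · have := hc (.inl u)
      simp only [hu, if_false]
      split_ifs <;> linarith
  · exfalso
    have hf₀ (u : S) : 0 ≤ f (A u) := hf (.inl u) (Finset.mem_univ _)
    have hX : X ⊆ {u | f (A u) = 0} := fun u hu => by
      have := hf (.inr u) (Finset.mem_univ _)
      simp only [Sum.elim_inr, hu, if_true, map_neg] at this
      exact le_antisymm (by linarith) (hf₀ u)
    have : f (A s) = 0 := hs _ ⟨isFaceOf_zeros hf₀, hX⟩
    simp [this] at hfs

/-- If `s` has a positive coefficient in some linear dependence that is nonnegative outside
of `X`, then such a dependence can be chosen among those of minimal support. -/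
theorem exists_circuit_of_dependence {S E : Type*} [Fintype S] [AddCommGroup E]
    [Module ℝ E] {A : S → E} {X : Set S} {s : S}
    (h : ∃ δ : S → ℝ, ∑ u, δ u • A u = 0 ∧ 0 < δ s ∧ ∀ u ∉ X, 0 ≤ δ u) :
    ∃ δ : S → ℝ, (∑ u, δ u • A u = 0 ∧ 0 < δ s ∧ ∀ u ∉ X, 0 ≤ δ u) ∧
      IsCircuitSupport A {u | δ u ≠ 0} := by
  obtain ⟨δ, hδ, hmin⟩ := exists_minimalFor_of_wellFoundedLT
    (fun δ : S → ℝ => ∑ u, δ u • A u = 0 ∧ 0 < δ s ∧ ∀ u ∉ X, 0 ≤ δ u)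
    (fun δ => {u | δ u ≠ 0}) h
  refine ⟨δ, hδ, δ, fun h0 => by simp [h0] at hδ, hδ.1, rfl, fun δ' hδ'0 hδ' hsub => ?_⟩
  obtain ⟨hdep, hs, hX⟩ := hδ
  have hsub' {u : S} (hu : δ u = 0) : δ' u = 0 := by
    by_contra hne
    exact hsub hne hu
  -- A dependence supported on the support of `δ` and nonpositive at `s` opposes `δ` in sign.
  have key (ε : S → ℝ) (hε : ∑ u, ε u • A u = 0) (hεsub : ∀ u, δ u = 0 → ε u = 0)
      (hεs : ε s ≤ 0) : ∀ u, δ u * ε u ≤ 0 := by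
    by_contra! hpos
    obtain ⟨t, ht, hconf, w, hw, hw0⟩ := exists_pos_sub_mul_conformal δ ε hpos
    have hle := hmin (j := fun u => δ u - t * ε u) ⟨?_, ?_, fun u hu => ?_⟩ ?_
    · exact hle hw hw0
    · simp only [sub_smul, mul_smul, Finset.sum_sub_distrib, ← Finset.smul_sum, hdep, hε]
      simp
    · nlinarith
    · rcases (hX u hu).eq_or_lt with h0 | h0
      · simp [← h0, hεsub u h0.symm]
      · exact nonneg_of_mul_nonneg_right (hconf u) h0
    · intro u hu h0
      exact hu (by simp [h0, hεsub u h0])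
  -- A dependence supported on the support of `δ` and negative at `s` has full support there.
  have opp (ε : S → ℝ) (hε : ∑ u, ε u • A u = 0) (hεsub : ∀ u, δ u = 0 → ε u = 0)
      (hεs : ε s < 0) : {u | δ u ≠ 0} ⊆ {u | ε u ≠ 0} := by
    have hop := key ε hε hεsub hεs.le
    have hle := hmin (j := -ε) ⟨by simpa using hε, by simpa using hεs, fun u hu => ?_⟩ ?_
    · intro u hu
      simpa using hle hu
    · rcases (hX u hu).eq_or_lt with h0 | h0
      · simp [hεsub u h0.symm]
      · simpa using nonpos_of_mul_nonpos_right (hop u) h0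
    · intro u hu h0
      exact hu (by simp [hεsub u h0])
  have hneg : ∑ u, (-δ') u • A u = 0 := by simpa using hδ'
  refine hsub.antisymm ?_
  rcases lt_trichotomy (δ' s) 0 with hlt | heq | hgt
  · exact opp δ' hδ' (fun u => hsub') hlt
  · refine absurd (funext fun u => ?_) hδ'0
    by_cases hu : δ u = 0
    · exact hsub' hu
    have h1 := key δ' hδ' (fun u => hsub') heq.le u
    have h2 := key (-δ') hneg (fun u hu => by simp [hsub' hu]) (by simp [heq]) u
    have h3 : δ u * δ' u = 0 := le_antisymm h1 (by simpa using h2)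
    exact (mul_eq_zero.1 h3).resolve_left hu
  · simpa using opp (-δ') hneg (fun u hu => by simp [hsub' hu]) (by simpa using hgt)

/-- In an acyclic family, an element of the face closure of `X` outside of `X` lies on a circuit
that meets `X` and is contained in the face closure. -/
theorem exists_circuit_of_mem_faceClosure {S E : Type*} [Fintype S] [AddCommGroup E]
    [Module ℝ E] {A : S → E} (hacyc : IsFaceOf A (∅ : Set S)) {X : Set S} {s : S}
    (hs : s ∈ faceClosure A X) (hsX : s ∉ X) :
    ∃ c : Set S, IsCircuitSupport A c ∧ s ∈ c ∧ (X ∩ c).Nonempty ∧ c ⊆ faceClosure A X := by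
  obtain ⟨δ, ⟨hdep, hδs, hX⟩, hcirc⟩ :=
    exists_circuit_of_dependence (exists_dependence_of_mem_faceClosure hs hsX)
  have hmap (f : E →ₗ[ℝ] ℝ) : ∑ u, δ u * f (A u) = 0 := by
    simpa using congrArg f hdep
  refine ⟨_, hcirc, hδs.ne', ?_, fun u hu => ?_⟩
  · by_contra hempty
    obtain ⟨f, -, hf⟩ := hacyc
    have hf (u : S) : 0 < f (A u) := hf u (Set.notMem_empty u)
    have hnonneg (u : S) : 0 ≤ δ u := by
      by_cases hu : u ∈ X
      · by_contra hne
        exact hempty ⟨u, hu, fun h0 => hne h0.ge⟩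
      · exact hX u hu
    have := (Finset.sum_eq_zero_iff_of_nonneg
      fun u _ => mul_nonneg (hnonneg u) (hf u).le).1 (hmap f) s (Finset.mem_univ s)
    exact (mul_pos hδs (hf s)).ne' this
  · obtain ⟨f, hf, hF⟩ := (isFaceOf_faceClosure A X).exists_nonneg
    have hnonneg (w : S) : 0 ≤ δ w * f (A w) := by
      by_cases hw : w ∈ X
      · have : f (A w) = 0 := (Set.ext_iff.1 hF w).1 (subset_faceClosure A X hw)
        simp [this]
      · exact mul_nonneg (hX w hw) (hf w)
    have := (Finset.sum_eq_zero_iff_of_nonneg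
      fun w _ => hnonneg w).1 (hmap f) u (Finset.mem_univ u)
    rw [hF]
    exact (mul_eq_zero.1 this).resolve_left hu

/-- The face closure of a member of an oriented building set is again a member. -/
theorem IsOrientedBuilding.faceClosure_mem {S E : Type*} [Fintype S] [AddCommGroup E]
    [Module ℝ E] {A : S → E} (hacyc : IsFaceOf A (∅ : Set S)) {B : Set (Set S)}
    (hB : IsOrientedBuilding A B) {X : Set S} (hX : X ∈ B) : faceClosure A X ∈ B := by
  obtain ⟨Y, hXY, hY⟩ := (Set.toFinite {Y | Y ∈ B ∧ X ⊆ Y ∧ Y ⊆ faceClosure A X}).exists_le_maximal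
    (a := X) ⟨hX, subset_rfl, subset_faceClosure A X⟩
  obtain ⟨hYB, -, hYF⟩ := hY.prop
  suffices faceClosure A X ⊆ Y from hYF.antisymm this ▸ hYB
  intro s hs
  by_contra hsY
  obtain ⟨c, hc, hsc, hXc, hcF⟩ :=
    exists_circuit_of_mem_faceClosure hacyc hs fun hsX => hsY (hXY hsX)
  have hmem := hB.1.2.2 Y hYB c (hB.2 c hc) (hXc.mono (Set.inter_subset_inter_left c hXY))
  exact hsY (hY.2 ⟨hmem, hXY.trans Set.subset_union_left, Set.union_subset hYF hcF⟩
    Set.subset_union_left (.inr hsc))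

/-- **Face closures of unions of intersecting blocks** (Corollary `carrier`). For a finite
acyclic family `A` of vectors of a finite-dimensional real inner product space and an oriented
building set `B` for `A`, if `b₁, b₂ ∈ B` intersect, then the smallest face of `A` containing
`b₁ ∪ b₂` belongs to `B`; in particular it belongs to the facial part
`{b ∈ B : b is a face of A}` of `B`. -/
theorem faceClosure_union_mem {S E : Type*} [NormedAddCommGroup E]
    [InnerProductSpace ℝ E] [FiniteDimensional ℝ E] [Fintype S]
    (A : S → E) (hacyc : IsFaceOf A (∅ : Set S))
    (B : Set (Set S)) (hB : IsOrientedBuilding A B) :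
    ∀ b₁ ∈ B, ∀ b₂ ∈ B, (b₁ ∩ b₂).Nonempty →
      faceClosure A (b₁ ∪ b₂) ∈ B ∧ IsFaceOf A (faceClosure A (b₁ ∪ b₂)) :=
  fun b₁ h₁ b₂ h₂ hne =>
    ⟨hB.faceClosure_mem hacyc (hB.1.2.2 b₁ h₁ b₂ h₂ hne), isFaceOf_faceClosure A _⟩
end
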